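/- arXiv:2501.03157 — 2 statements merged into one kernel-verified Lean document; each statement's English description precedes it below -/
import Mathlib

section
/- Let α ∈ ℝ be irrational with β(α) > 0 and let λ ∈ ℝ satisfy |λ| < e^{β(α)}. Then for every θ ∈ ℝ, the almost Mathieu operator H_{λ,α,θ}, defined on ℓ²(ℤ) by (H_{λ,α,θ}u)(k) = u(k+1) + u(k-1) + 2λ cos(2π(θ + kα))u(k), has no eigenvalues: for every E ∈ ℝ, the equation H_{λ,α,θ}u = Eu has no nonzero solution u ∈ ℓ²(ℤ). -/
open Filter Matrix

noncomputable section

attribute [local instance] Matrix.linftyOpNormedRing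

/-- One-step transfer matrix `A_k(E)`. -/
def oneStep (V : ℤ → ℝ) (E : ℂ) (k : ℤ) : Matrix (Fin 2) (Fin 2) ℂ :=
  !![E - (V k : ℂ), -1; 1, 0]

/-- For `j ≤ k`, the product `A_{k-1}(E) A_{k-2}(E) ⋯ A_j(E)`. -/
def transferFwd (V : ℤ → ℝ) (E : ℂ) (k j : ℤ) : Matrix (Fin 2) (Fin 2) ℂ :=
  (((List.range (k - j).toNat).map fun i => oneStep V E (k - 1 - i)).prod)

/-- Multi-step transfer matrix `A_{k,j}(E)`. -/
def transfer (V : ℤ → ℝ) (E : ℂ) (k j : ℤ) : Matrix (Fin 2) (Fin 2) ℂ :=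
  if j ≤ k then transferFwd V E k j else (transferFwd V E j k)⁻¹

/-- `𝓛(E) = limsup_{k→∞} sup_{j∈ℤ} ln‖A_{k+j,j}(E)‖ / k`, as an extended real number. -/
def transferExp (V : ℤ → ℝ) (E : ℂ) : EReal :=
  Filter.limsup
    (fun k : ℕ => ⨆ j : ℤ, ((Real.log ‖transfer V E ((k : ℤ) + j) j‖ / (k : ℝ) : ℝ) : EReal))
    Filter.atTop

/-- `β(α) = limsup_{k→∞} (-ln ‖kα‖_𝕋)/k`, where `‖x‖_𝕋 = dist(x, ℤ)`. -/
def beta (α : ℝ) : EReal :=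
  Filter.limsup
    (fun k : ℕ => (((-Real.log |(k : ℝ) * α - round ((k : ℝ) * α)|) / (k : ℝ) : ℝ) : EReal))
    Filter.atTop

section

open MeasureTheory AddCircle

/-- The one-step transfer matrix at energy `z` and potential value `w`. -/
def stepMatrix (z w : ℂ) : Matrix (Fin 2) (Fin 2) ℂ := !![z - w, -1; 1, 0]

/-- The ordered product `T (n - 1) * ⋯ * T 0`. -/
def prodSeq (T : ℕ → Matrix (Fin 2) (Fin 2) ℂ) : ℕ → Matrix (Fin 2) (Fin 2) ℂ
  | 0 => 1
  | n + 1 => T n * prodSeq T n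

@[simp] lemma prodSeq_zero (T : ℕ → Matrix (Fin 2) (Fin 2) ℂ) : prodSeq T 0 = 1 := rfl

lemma prodSeq_succ (T : ℕ → Matrix (Fin 2) (Fin 2) ℂ) (n : ℕ) :
    prodSeq T (n + 1) = T n * prodSeq T n := rfl

lemma prodSeq_add (T : ℕ → Matrix (Fin 2) (Fin 2) ℂ) (m n : ℕ) :
    prodSeq T (m + n) = prodSeq (fun i => T (m + i)) n * prodSeq T m := by
  induction n with
  | zero => simp
  | succ n ih => rw [← add_assoc, prodSeq_succ, ih, prodSeq_succ, mul_assoc]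

lemma prodSeq_succ' (T : ℕ → Matrix (Fin 2) (Fin 2) ℂ) (n : ℕ) :
    prodSeq T (n + 1) = prodSeq (fun i => T (i + 1)) n * T 0 := by
  rw [add_comm n 1, prodSeq_add, prodSeq_succ, prodSeq_zero, mul_one]
  simp only [add_comm]

lemma det_stepMatrix (z w : ℂ) : (stepMatrix z w).det = 1 := by
  simp [stepMatrix, Matrix.det_fin_two]

lemma det_prodSeq (T : ℕ → Matrix (Fin 2) (Fin 2) ℂ) (hT : ∀ i, (T i).det = 1) (n : ℕ) :
    (prodSeq T n).det = 1 := by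
  induction n with
  | zero => simp
  | succ n ih => rw [prodSeq_succ, Matrix.det_mul, hT, ih, one_mul]

lemma row_sum_le_norm (A : Matrix (Fin 2) (Fin 2) ℂ) (i : Fin 2) :
    ‖A i 0‖ + ‖A i 1‖ ≤ ‖A‖ := by
  rw [Matrix.linfty_opNorm_def]
  have h : (∑ j, ‖A i j‖₊) ≤ Finset.univ.sup fun i => ∑ j, ‖A i j‖₊ :=
    Finset.le_sup (f := fun i => ∑ j, ‖A i j‖₊) (Finset.mem_univ i)
  have h' : ((∑ j, ‖A i j‖₊ : NNReal) : ℝ) ≤ _ := NNReal.coe_le_coe.2 h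
  simpa [Fin.sum_univ_two] using h'

lemma entry_le_norm (A : Matrix (Fin 2) (Fin 2) ℂ) (i j : Fin 2) : ‖A i j‖ ≤ ‖A‖ := by
  have h := row_sum_le_norm A i
  have h0 := norm_nonneg (A i 0)
  have h1 := norm_nonneg (A i 1)
  fin_cases j
  · change ‖A i 0‖ ≤ ‖A‖
    linarith
  · change ‖A i 1‖ ≤ ‖A‖
    linarith

lemma norm_le_of_row_sum {A : Matrix (Fin 2) (Fin 2) ℂ} {b : ℝ}
    (h : ∀ i, ‖A i 0‖ + ‖A i 1‖ ≤ b) : ‖A‖ ≤ b := by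
  have hb : 0 ≤ b := (add_nonneg (norm_nonneg _) (norm_nonneg _)).trans (h 0)
  rw [Matrix.linfty_opNorm_def]
  have : (Finset.univ.sup fun i => ∑ j, ‖A i j‖₊) ≤ b.toNNReal := by
    refine Finset.sup_le fun i _ => ?_
    rw [← NNReal.coe_le_coe, Real.coe_toNNReal _ hb]
    simpa [Fin.sum_univ_two] using h i
  have h' := NNReal.coe_le_coe.2 this
  rwa [Real.coe_toNNReal _ hb] at h'

lemma norm_le_two_mul {A : Matrix (Fin 2) (Fin 2) ℂ} {b : ℝ}
    (h : ∀ i j, ‖A i j‖ ≤ b) : ‖A‖ ≤ 2 * b :=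
  norm_le_of_row_sum fun i => by linarith [h i 0, h i 1]

lemma one_le_norm_of_det_eq_one {A : Matrix (Fin 2) (Fin 2) ℂ} (h : A.det = 1) : 1 ≤ ‖A‖ := by
  rw [Matrix.det_fin_two] at h
  have h0 := row_sum_le_norm A 0
  have h1 := row_sum_le_norm A 1
  have h2 : (1 : ℝ) ≤ ‖A 0 0‖ * ‖A 1 1‖ + ‖A 0 1‖ * ‖A 1 0‖ := by
    rw [← norm_mul, ← norm_mul]
    calc (1 : ℝ) = ‖A 0 0 * A 1 1 - A 0 1 * A 1 0‖ := by rw [h, norm_one]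
      _ ≤ _ := norm_sub_le _ _
  nlinarith [norm_nonneg (A 0 0), norm_nonneg (A 0 1), norm_nonneg (A 1 0), norm_nonneg (A 1 1),
    norm_nonneg A]

lemma norm_prodSeq_le {T : ℕ → Matrix (Fin 2) (Fin 2) ℂ} {M : ℝ} (hT : ∀ i, ‖T i‖ ≤ M) (n : ℕ) :
    ‖prodSeq T n‖ ≤ M ^ n := by
  have hM : 0 ≤ M := (norm_nonneg _).trans (hT 0)
  induction n with
  | zero => simp
  | succ n ih =>
    rw [prodSeq_succ, pow_succ']
    exact (norm_mul_le _ _).trans (mul_le_mul (hT n) ih (norm_nonneg _) hM)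

lemma prodSeq_sub_prodSeq (T S : ℕ → Matrix (Fin 2) (Fin 2) ℂ) (n : ℕ) :
    prodSeq T n - prodSeq S n = ∑ j ∈ Finset.range n,
      prodSeq (fun i => S (j + 1 + i)) (n - 1 - j) * (T j - S j) * prodSeq T j := by
  induction n with
  | zero => simp
  | succ n ih =>
    have h : prodSeq T (n + 1) - prodSeq S (n + 1)
        = S n * (prodSeq T n - prodSeq S n) + (T n - S n) * prodSeq T n := by
      rw [prodSeq_succ, prodSeq_succ]; noncomm_ring
    rw [h, ih, Finset.sum_range_succ, Finset.mul_sum]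
    congr 1
    · refine Finset.sum_congr rfl fun j hj => ?_
      have hj' := Finset.mem_range.1 hj
      obtain ⟨k, rfl⟩ : ∃ k, n = j + 1 + k := ⟨n - (j + 1), by omega⟩
      have e1 : j + 1 + k - 1 - j = k := by omega
      have e2 : j + 1 + k + 1 - 1 - j = k + 1 := by omega
      rw [e1, e2, prodSeq_succ]
      simp only [mul_assoc]
    · simp

/-- Telescoping bound for the difference of two products. -/
lemma norm_prodSeq_sub_le {T S : ℕ → Matrix (Fin 2) (Fin 2) ℂ} {C K δ : ℝ} (hK : 1 ≤ K)
    (hC : 0 ≤ C) (hT : ∀ n, ‖prodSeq T n‖ ≤ C * K ^ n)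
    (hS : ∀ j n, ‖prodSeq (fun i => S (j + i)) n‖ ≤ C * K ^ n)
    (hTS : ∀ i, ‖T i - S i‖ ≤ δ) (n : ℕ) :
    ‖prodSeq T n - prodSeq S n‖ ≤ n * (C ^ 2 * K ^ n * δ) := by
  rw [prodSeq_sub_prodSeq]
  have hδ : 0 ≤ δ := (norm_nonneg _).trans (hTS 0)
  have hK0 : 0 ≤ K := by linarith
  refine (norm_sum_le _ _).trans ?_
  have : ∀ j ∈ Finset.range n,
      ‖prodSeq (fun i => S (j + 1 + i)) (n - 1 - j) * (T j - S j) * prodSeq T j‖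
        ≤ C ^ 2 * K ^ n * δ := by
    intro j hj
    have hj' := Finset.mem_range.1 hj
    calc _ ≤ ‖prodSeq (fun i => S (j + 1 + i)) (n - 1 - j)‖ * ‖T j - S j‖ * ‖prodSeq T j‖ :=
          (norm_mul_le _ _).trans (by gcongr; exact norm_mul_le _ _)
      _ ≤ (C * K ^ (n - 1 - j)) * δ * (C * K ^ j) := by
          gcongr
          · exact hS _ _
          · exact hTS j
          · exact hT j
      _ = C ^ 2 * K ^ (n - 1 - j + j) * δ := by rw [pow_add]; ring
      _ ≤ _ := by gcongr; omega
  refine (Finset.sum_le_sum this).trans ?_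
  simp

lemma prodSeq_entries (z : ℂ) (w : ℕ → ℂ) (n : ℕ) :
    prodSeq (fun i => stepMatrix z (w i)) (n + 1) 0 1
        = - prodSeq (fun i => stepMatrix z (w (i + 1))) n 0 0 ∧
    prodSeq (fun i => stepMatrix z (w i)) (n + 1) 1 0
        = prodSeq (fun i => stepMatrix z (w i)) n 0 0 ∧
    prodSeq (fun i => stepMatrix z (w i)) (n + 1) 1 1
        = prodSeq (fun i => stepMatrix z (w i)) n 0 1 := by
  refine ⟨?_, ?_, ?_⟩
  · rw [prodSeq_succ']
    simp [Matrix.mul_apply, Fin.sum_univ_two, stepMatrix]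
  all_goals
    rw [prodSeq_succ]
    simp [Matrix.mul_apply, Fin.sum_univ_two, stepMatrix]

lemma prodSeq_zero_zero_add_two (z : ℂ) (w : ℕ → ℂ) (n : ℕ) :
    prodSeq (fun i => stepMatrix z (w i)) (n + 2) 0 0
      = (z - w 0) * prodSeq (fun i => stepMatrix z (w (i + 1))) (n + 1) 0 0
        - prodSeq (fun i => stepMatrix z (w (i + 2))) n 0 0 := by
  rw [prodSeq_succ', Matrix.mul_apply, Fin.sum_univ_two]
  rw [(prodSeq_entries z (fun i => w (i + 1)) n).1]
  simp [stepMatrix]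
  ring

/-- A bound on all top-left entries bounds the transfer matrices. -/
lemma norm_prodSeq_le_of_entry {z : ℂ} {w : ℕ → ℂ} {n : ℕ} {b : ℝ}
    (h : ∀ j k, n ≤ k → k ≤ n + 2 →
      ‖prodSeq (fun i => stepMatrix z (w (i + j))) k 0 0‖ ≤ b) :
    ‖prodSeq (fun i => stepMatrix z (w i)) (n + 2)‖ ≤ 2 * b := by
  have e := prodSeq_entries z w (n + 1)
  have e' := prodSeq_entries z w n
  refine norm_le_two_mul fun i j => ?_
  fin_cases i <;> fin_cases j
  · simpa using h 0 (n + 2) (by omega) (by omega)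
  · simpa [e.1] using h 1 (n + 1) (by omega) (by omega)
  · simpa [e.2.1] using h 0 (n + 1) (by omega) (by omega)
  · simpa [e.2.2, e'.1] using h 1 n (by omega) (by omega)

lemma norm_stepMatrix_le {z w : ℂ} {b : ℝ} (h : ‖z - w‖ ≤ b) : ‖stepMatrix z w‖ ≤ b + 1 := by
  have hb := (norm_nonneg _).trans h
  refine norm_le_of_row_sum fun i => ?_
  fin_cases i <;> simp [stepMatrix, h]
  linarith

lemma norm_stepMatrix_sub_le (z z' w w' : ℂ) :
    ‖stepMatrix z w - stepMatrix z' w'‖ ≤ ‖(z - z') - (w - w')‖ := by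
  refine norm_le_of_row_sum fun i => ?_
  fin_cases i
  · simp [stepMatrix]; apply le_of_eq; congr 1; ring
  · simp [stepMatrix]

/-- The `n × n` Jacobi matrix with diagonal `w` and unit off-diagonal entries. -/
def jacobi (w : ℕ → ℂ) (n : ℕ) : Matrix (Fin n) (Fin n) ℂ :=
  Matrix.of fun i j => if (i : ℕ) = j then w i
    else if (i : ℕ) = j + 1 ∨ (j : ℕ) = i + 1 then 1 else 0

lemma det_scalar_sub_jacobi (z : ℂ) (n : ℕ) : ∀ w : ℕ → ℂ,
    (Matrix.scalar (Fin n) z - jacobi w n).det = prodSeq (fun i => stepMatrix z (w i)) n 0 0 := by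
  induction n using Nat.twoStepInduction with
  | zero => simp
  | one => intro w; simp [jacobi, prodSeq_succ, stepMatrix]
  | more n ih0 ih1 =>
    intro w
    rw [prodSeq_zero_zero_add_two, ← ih0 fun i => w (i + 2), ← ih1 fun i => w (i + 1)]
    rw [Matrix.det_succ_row_zero, Fin.sum_univ_succ, Fin.sum_univ_succ, Finset.sum_eq_zero,
      add_zero]
    · have h0 : (Matrix.scalar (Fin (n + 2)) z - jacobi w (n + 2)).submatrix Fin.succ
          (Fin.succAbove 0) =
          Matrix.scalar (Fin (n + 1)) z - jacobi (fun i => w (i + 1)) (n + 1) := by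
        ext i j
        simp [jacobi, Matrix.diagonal_apply]
      have h1 : ((Matrix.scalar (Fin (n + 2)) z - jacobi w (n + 2)).submatrix Fin.succ
          (Fin.succAbove (Fin.succ 0))).det =
          - (Matrix.scalar (Fin n) z - jacobi (fun i => w (i + 2)) n).det := by
        rw [Matrix.det_succ_column_zero, Fin.sum_univ_succ, Finset.sum_eq_zero, add_zero]
        · have h2 : (((Matrix.scalar (Fin (n + 2)) z - jacobi w (n + 2)).submatrix Fin.succ
            (Fin.succAbove (Fin.succ 0))).submatrix (Fin.succAbove 0) Fin.succ) =
            Matrix.scalar (Fin n) z - jacobi (fun i => w (i + 2)) n := by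
            ext i j
            have hs : (Fin.succAbove (Fin.succ (0 : Fin (n + 1))) j.succ) = j.succ.succ := by
              rw [Fin.succ_succAbove_succ, Fin.zero_succAbove]
            simp only [Matrix.submatrix_apply, hs, Fin.zero_succAbove]
            simp [jacobi, Matrix.diagonal_apply]
          rw [h2]
          simp [jacobi]
        · intro i _
          simp [jacobi, Fin.ext_iff]
      rw [h0, h1]
      simp [jacobi]
      ring
    · intro i _
      simp [jacobi, Fin.ext_iff]

lemma isHermitian_jacobi {w : ℕ → ℂ} (hw : ∀ i, star (w i) = w i) (n : ℕ) :
    (jacobi w n).IsHermitian := by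
  ext i j
  simp only [Matrix.conjTranspose_apply, jacobi, Matrix.of_apply]
  split_ifs with h1 h2 h3 h4 h5 h6 <;> first | omega | simp
  rw [h1]; exact hw _

lemma sum_range_tridiag_le (n i : ℕ) (b : ℝ) (hb : 0 ≤ b) :
    (∑ j ∈ Finset.range n, if i = j then b
      else if i = j + 1 ∨ j = i + 1 then 1 else 0) ≤ b + 2 := by
  have h : ∀ j, (if i = j then b else if i = j + 1 ∨ j = i + 1 then 1 else 0)
      ≤ (if i = j then b else 0) + (if i = j + 1 then 1 else 0)
        + (if i + 1 = j then (1 : ℝ) else 0) := by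
    intro j
    split_ifs <;> first | omega | linarith
  refine (Finset.sum_le_sum fun j _ => h j).trans ?_
  rw [Finset.sum_add_distrib, Finset.sum_add_distrib, Finset.sum_ite_eq, Finset.sum_ite_eq]
  have h2 : (∑ j ∈ Finset.range n, if i = j + 1 then (1 : ℝ) else 0) ≤ 1 := by
    cases i with
    | zero => simp
    | succ i =>
      simp only [Nat.add_right_cancel_iff, Finset.sum_ite_eq]
      split_ifs <;> simp
  split_ifs <;> linarith

lemma norm_jacobi_le {w : ℕ → ℂ} {b : ℝ} (hw : ∀ i, ‖w i‖ ≤ b) (n : ℕ) :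
    ‖jacobi w n‖ ≤ b + 2 := by
  have hb : 0 ≤ b := (norm_nonneg _).trans (hw 0)
  have hb2 : 0 ≤ b + 2 := by linarith
  rw [Matrix.linfty_opNorm_def]
  have : (Finset.univ.sup fun i => ∑ j, ‖jacobi w n i j‖₊) ≤ (b + 2).toNNReal := by
    refine Finset.sup_le fun i _ => ?_
    rw [← NNReal.coe_le_coe, Real.coe_toNNReal _ hb2]
    push_cast
    refine le_trans ?_ (sum_range_tridiag_le n i b hb)
    rw [Finset.sum_range]
    refine Finset.sum_le_sum fun j _ => ?_
    simp only [jacobi, Matrix.of_apply]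
    split_ifs
    · exact hw _
    · simp
    · simp
  have h' := NNReal.coe_le_coe.2 this
  rwa [Real.coe_toNNReal _ hb2] at h'

lemma norm_entry_le_norm {n : ℕ} (A : Matrix (Fin n) (Fin n) ℂ) (i j : Fin n) :
    ‖A i j‖ ≤ ‖A‖ := by
  rw [Matrix.linfty_opNorm_def]
  have h1 : ‖A i j‖₊ ≤ ∑ k, ‖A i k‖₊ :=
    Finset.single_le_sum (f := fun k => ‖A i k‖₊) (fun _ _ => by simp) (Finset.mem_univ j)
  have h2 : (∑ k, ‖A i k‖₊) ≤ Finset.univ.sup fun i => ∑ k, ‖A i k‖₊ :=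
    Finset.le_sup (f := fun i => ∑ k, ‖A i k‖₊) (Finset.mem_univ i)
  exact_mod_cast h1.trans h2

lemma trace_pow_eq_sum_eigenvalues {n : ℕ} {A : Matrix (Fin n) (Fin n) ℂ} (hA : A.IsHermitian)
    (k : ℕ) : (A ^ k).trace = ∑ i, (hA.eigenvalues i : ℂ) ^ k := by
  conv_lhs => rw [hA.spectral_theorem, ← map_pow, Unitary.conjStarAlgAut_apply,
    Matrix.trace_mul_cycle]
  simp [Matrix.diagonal_pow, Matrix.trace_diagonal]

lemma abs_eigenvalues_le_norm {n : ℕ} {A : Matrix (Fin n) (Fin n) ℂ} (hA : A.IsHermitian)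
    (i : Fin n) : |hA.eigenvalues i| ≤ ‖A‖ := by
  set v : Fin n → ℂ := ⇑(hA.eigenvectorBasis i) with hv
  have hAv : A *ᵥ v = hA.eigenvalues i • v := hA.mulVec_eigenvectorBasis i
  have hv0 : v ≠ 0 := by
    intro h
    apply hA.eigenvectorBasis.toBasis.ne_zero i
    ext j
    simpa [hv] using congrFun h j
  have h := Matrix.linfty_opNorm_mulVec A v
  rw [hAv, norm_smul, Real.norm_eq_abs] at h
  exact le_of_mul_le_mul_right h (norm_pos_iff.2 hv0)

lemma exists_spectrum_jacobi {w : ℕ → ℂ} {b : ℝ} (hw : ∀ i, star (w i) = w i)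
    (hb : ∀ i, ‖w i‖ ≤ b) (n : ℕ) :
    ∃ e : Fin n → ℝ, (∀ i, |e i| ≤ b + 2) ∧
      (∀ z, prodSeq (fun i => stepMatrix z (w i)) n 0 0 = ∏ i, (z - e i)) ∧
      ∀ k, (jacobi w n ^ k).trace = ∑ i, (e i : ℂ) ^ k := by
  have hA := isHermitian_jacobi hw n
  refine ⟨hA.eigenvalues, fun i => ?_, fun z => ?_, trace_pow_eq_sum_eigenvalues hA⟩
  · exact (abs_eigenvalues_le_norm hA i).trans (norm_jacobi_le hb n)
  · rw [← det_scalar_sub_jacobi, ← Matrix.eval_charpoly, hA.charpoly_eq, Polynomial.eval_prod]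
    simp

/-- The function `2 cos (2 π y)` on the circle, as a complex-valued trigonometric polynomial. -/
def cosSymbol (y : UnitAddCircle) : ℂ := fourier 1 y + fourier (-1) y

/-- The matrix element `⟨δ_j, H_x ^ k δ_0⟩` of the almost Mathieu operator with potential
`c * cosSymbol (x + i • a)`. -/
def powerCoeff (c : ℂ) (a : UnitAddCircle) : ℕ → ℤ → UnitAddCircle → ℂ
  | 0, j, _ => if j = 0 then 1 else 0
  | k + 1, j, x => powerCoeff c a k (j - 1) x + powerCoeff c a k (j + 1) x
      + c * cosSymbol (x + j • a) * powerCoeff c a k j x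

lemma fourier_add_apply (n : ℤ) (x y : UnitAddCircle) :
    (fourier n (x + y) : ℂ) = fourier n x * fourier n y := by
  rw [fourier_apply, fourier_apply, fourier_apply, smul_add, toCircle_add]
  simp

lemma norm_fourier_apply (n : ℤ) (x : UnitAddCircle) : ‖(fourier n x : ℂ)‖ = 1 := by
  rw [fourier_apply]; exact Circle.norm_coe _

lemma continuous_cosSymbol : Continuous cosSymbol := by
  unfold cosSymbol; fun_prop

lemma star_cosSymbol (y : UnitAddCircle) : star (cosSymbol y) = cosSymbol y := by
  rw [cosSymbol, star_add, fourier_neg]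
  simp [add_comm]

lemma norm_cosSymbol_le (y : UnitAddCircle) : ‖cosSymbol y‖ ≤ 2 := by
  refine (norm_add_le _ _).trans ?_
  rw [norm_fourier_apply, norm_fourier_apply]; norm_num

lemma continuous_powerCoeff (c : ℂ) (a : UnitAddCircle) (k : ℕ) :
    ∀ j, Continuous (powerCoeff c a k j) := by
  induction k with
  | zero => intro j; exact continuous_const
  | succ k ih =>
    intro j
    have h1 := ih (j - 1)
    have h2 := ih (j + 1)
    have h3 := ih j
    have h4 := continuous_cosSymbol
    change Continuous fun x => powerCoeff c a k (j - 1) x + powerCoeff c a k (j + 1) x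
      + c * cosSymbol (x + j • a) * powerCoeff c a k j x
    fun_prop

lemma powerCoeff_eq_zero (c : ℂ) (a x : UnitAddCircle) (k : ℕ) :
    ∀ j : ℤ, (k : ℤ) < |j| → powerCoeff c a k j x = 0 := by
  induction k with
  | zero => intro j hj; simpa [powerCoeff] using hj
  | succ k ih =>
    intro j hj
    push_cast at hj
    have h1 : (k : ℤ) < |j - 1| := by
      rcases abs_cases j with ⟨h, _⟩ | ⟨h, _⟩ <;> rcases abs_cases (j - 1) with ⟨h', _⟩ | ⟨h', _⟩ <;>
        omega
    have h2 : (k : ℤ) < |j + 1| := by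
      rcases abs_cases j with ⟨h, _⟩ | ⟨h, _⟩ <;> rcases abs_cases (j + 1) with ⟨h', _⟩ | ⟨h', _⟩ <;>
        omega
    rw [powerCoeff, ih _ h1, ih _ h2, ih _ (by omega)]
    simp

lemma norm_powerCoeff_le (c : ℂ) (a x : UnitAddCircle) (k : ℕ) :
    ∀ j : ℤ, ‖powerCoeff c a k j x‖ ≤ (2 * ‖c‖ + 2) ^ k := by
  induction k with
  | zero => intro j; rw [powerCoeff]; split_ifs <;> simp
  | succ k ih =>
    intro j
    rw [powerCoeff]
    refine (norm_add_le _ _).trans ((add_le_add (norm_add_le _ _) le_rfl).trans ?_)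
    rw [norm_mul, norm_mul]
    have h1 := ih (j - 1)
    have h2 := ih (j + 1)
    have h3 : ‖c‖ * ‖cosSymbol (x + j • a)‖ * ‖powerCoeff c a k j x‖
        ≤ ‖c‖ * 2 * (2 * ‖c‖ + 2) ^ k := by
      gcongr
      · exact norm_cosSymbol_le _
      · exact ih j
    rw [pow_succ]
    linarith

/-- Continuous functions all of whose modulations have bounded discrepancy along the rotation
by `a`. -/
def BoundedDiscrepancy (a : UnitAddCircle) (g : UnitAddCircle → ℂ) : Prop :=
  Continuous g ∧ ∀ l : ℤ, ∃ C : ℝ, ∀ (n : ℕ) (x : UnitAddCircle),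
    ‖∑ i ∈ Finset.range n, fourier l (x + i • a) * g (x + i • a)
      - n * ∫ y, fourier l y * g y ∂haarAddCircle‖ ≤ C

lemma integrable_of_continuous {g : UnitAddCircle → ℂ} (hg : Continuous g) :
    Integrable g haarAddCircle :=
  hg.integrable_of_hasCompactSupport (HasCompactSupport.of_compactSpace g)

namespace BoundedDiscrepancy

variable {a : UnitAddCircle} {g h : UnitAddCircle → ℂ}

lemma add (hg : BoundedDiscrepancy a g) (hh : BoundedDiscrepancy a h) :
    BoundedDiscrepancy a (fun x => g x + h x) := by
  have hgc := hg.1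
  have hhc := hh.1
  refine ⟨by fun_prop, fun l => ?_⟩
  obtain ⟨C, hC⟩ := hg.2 l
  obtain ⟨D, hD⟩ := hh.2 l
  refine ⟨C + D, fun n x => ?_⟩
  have e : ∫ y, fourier l y * (g y + h y) ∂haarAddCircle
      = ∫ y, fourier l y * g y ∂haarAddCircle + ∫ y, fourier l y * h y ∂haarAddCircle := by
    rw [← integral_add]
    · simp only [mul_add]
    · exact integrable_of_continuous (by fun_prop)
    · exact integrable_of_continuous (by fun_prop)
  rw [e]
  simp only [mul_add, Finset.sum_add_distrib]
  rw [add_sub_add_comm]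
  exact (norm_add_le _ _).trans (add_le_add (hC n x) (hD n x))

lemma const_mul (c : ℂ) (hg : BoundedDiscrepancy a g) :
    BoundedDiscrepancy a (fun x => c * g x) := by
  have hgc := hg.1
  refine ⟨by fun_prop, fun l => ?_⟩
  obtain ⟨C, hC⟩ := hg.2 l
  refine ⟨‖c‖ * C, fun n x => ?_⟩
  simp only [mul_left_comm _ c]
  rw [integral_const_mul, ← Finset.mul_sum, mul_left_comm, ← mul_sub, norm_mul]
  gcongr
  exact hC n x

lemma fourier_mul (m : ℤ) (hg : BoundedDiscrepancy a g) :
    BoundedDiscrepancy a (fun x => fourier m x * g x) := by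
  have hgc := hg.1
  refine ⟨by fun_prop, fun l => ?_⟩
  obtain ⟨C, hC⟩ := hg.2 (l + m)
  refine ⟨C, fun n x => ?_⟩
  simpa only [fourier_add, mul_assoc] using hC n x

end BoundedDiscrepancy

lemma fourier_ne_one {a : UnitAddCircle} (ha : addOrderOf a = 0) {l : ℤ} (hl : l ≠ 0) :
    (fourier l a : ℂ) ≠ 1 := by
  intro h
  rw [fourier_apply] at h
  have h1 : toCircle (l • a) = toCircle (0 : UnitAddCircle) := by
    rw [toCircle_zero]; exact Circle.ext h
  have h2 : l • a = 0 := injective_toCircle one_ne_zero h1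
  exact addOrderOf_eq_zero_iff.1 ha (isOfFinAddOrder_iff_zsmul_eq_zero.2 ⟨l, hl, h2⟩)

lemma integral_fourier (l : ℤ) :
    ∫ y : UnitAddCircle, (fourier l y : ℂ) ∂haarAddCircle = if l = 0 then 1 else 0 := by
  have h := congrFun (fourierCoeff_fourier (T := 1) l) 0
  rw [fourierCoeff] at h
  simp only [neg_zero, fourier_zero, one_smul] at h
  rw [h, Pi.single_apply]
  simp only [eq_comm]

lemma boundedDiscrepancy_one {a : UnitAddCircle} (ha : addOrderOf a = 0) :
    BoundedDiscrepancy a (fun _ => 1) := by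
  refine ⟨continuous_const, fun l => ?_⟩
  simp only [mul_one, integral_fourier]
  by_cases hl : l = 0
  · exact ⟨0, fun n x => by simp [hl]⟩
  refine ⟨2 / ‖(fourier l a : ℂ) - 1‖, fun n x => ?_⟩
  have hne := fourier_ne_one ha hl
  have hpow : ∀ i : ℕ, (fourier l (x + i • a) : ℂ) = fourier l x * (fourier l a : ℂ) ^ i := by
    intro i
    rw [fourier_add_apply]
    congr 1
    induction i with
    | zero => simp
    | succ i ih => rw [succ_nsmul, fourier_add_apply, ih, pow_succ]
  simp only [hpow, if_neg hl, mul_zero, sub_zero]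
  rw [← Finset.mul_sum, geom_sum_eq hne, norm_mul, norm_fourier_apply, one_mul, norm_div]
  gcongr
  refine (norm_sub_le _ _).trans ?_
  rw [norm_pow, norm_fourier_apply]
  norm_num

lemma boundedDiscrepancy_powerCoeff {a : UnitAddCircle} (ha : addOrderOf a = 0) (c : ℂ) (k : ℕ) :
    ∀ j, BoundedDiscrepancy a (powerCoeff c a k j) := by
  induction k with
  | zero =>
    intro j
    have := (boundedDiscrepancy_one ha).const_mul (if j = 0 then 1 else 0)
    simp only [mul_one] at this
    exact this
  | succ k ih =>
    intro j
    have h1 := (((ih j).fourier_mul 1).const_mul (c * fourier 1 (j • a)))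
    have h2 := (((ih j).fourier_mul (-1)).const_mul (c * fourier (-1) (j • a)))
    have h := ((ih (j - 1)).add (ih (j + 1))).add (h1.add h2)
    convert h using 2 with x
    rw [powerCoeff, cosSymbol, fourier_add_apply, fourier_add_apply]
    ring

/-- Fourier coefficients of `powerCoeff`. -/
def powerFourier (c : ℂ) (a : UnitAddCircle) (k : ℕ) (j l : ℤ) : ℂ :=
  ∫ x, fourier (-l) x * powerCoeff c a k j x ∂haarAddCircle

lemma powerFourier_zero (c : ℂ) (a : UnitAddCircle) (j l : ℤ) :
    powerFourier c a 0 j l = if j = 0 ∧ l = 0 then 1 else 0 := by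
  simp only [powerFourier, powerCoeff]
  rw [integral_mul_const, integral_fourier]
  by_cases hj : j = 0 <;> by_cases hl : l = 0 <;> simp [hj, hl]

lemma integral_add_four {f₁ f₂ f₃ f₄ : UnitAddCircle → ℂ} (h₁ : Integrable f₁ haarAddCircle)
    (h₂ : Integrable f₂ haarAddCircle) (h₃ : Integrable f₃ haarAddCircle)
    (h₄ : Integrable f₄ haarAddCircle) :
    ∫ x, (f₁ x + f₂ x + f₃ x + f₄ x) ∂haarAddCircle = ∫ x, f₁ x ∂haarAddCircle
      + ∫ x, f₂ x ∂haarAddCircle + ∫ x, f₃ x ∂haarAddCircle + ∫ x, f₄ x ∂haarAddCircle := by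
  rw [integral_add (f := fun x => f₁ x + f₂ x + f₃ x) ((h₁.add h₂).add h₃) h₄,
    integral_add (f := fun x => f₁ x + f₂ x) (h₁.add h₂) h₃, integral_add h₁ h₂]

lemma powerFourier_succ (c : ℂ) (a : UnitAddCircle) (k : ℕ) (j l : ℤ) :
    powerFourier c a (k + 1) j l = powerFourier c a k (j - 1) l + powerFourier c a k (j + 1) l
      + c * (fourier 1 (j • a) * powerFourier c a k j (l - 1)
        + fourier (-1) (j • a) * powerFourier c a k j (l + 1)) := by
  have hc := continuous_powerCoeff c a k
  have hint : ∀ (b : ℂ) (m i : ℤ),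
      Integrable (fun x => b * (fourier m x * powerCoeff c a k i x)) haarAddCircle := by
    intro b m i
    have := hc i
    exact integrable_of_continuous (by fun_prop)
  have e : ∀ x : UnitAddCircle, fourier (-l) x * powerCoeff c a (k + 1) j x
      = ((1 * (fourier (-l) x * powerCoeff c a k (j - 1) x)
        + 1 * (fourier (-l) x * powerCoeff c a k (j + 1) x))
        + (c * fourier 1 (j • a)) * (fourier (-(l - 1)) x * powerCoeff c a k j x))
        + (c * fourier (-1) (j • a)) * (fourier (-(l + 1)) x * powerCoeff c a k j x) := by
    intro x
    have e1 : -(l - 1) = -l + 1 := by ring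
    have e2 : -(l + 1) = -l + -1 := by ring
    rw [e1, e2, fourier_add, fourier_add, powerCoeff, cosSymbol, fourier_add_apply,
      fourier_add_apply]
    ring
  rw [powerFourier]
  simp only [e]
  rw [integral_add_four (hint _ _ _) (hint _ _ _) (hint _ _ _) (hint _ _ _)]
  simp only [integral_const_mul, powerFourier]
  ring

/-- Aubry duality for the moments of the density of states. -/
lemma powerFourier_duality {c : ℂ} (hc : c ≠ 0) (a : UnitAddCircle) (k : ℕ) :
    ∀ j l, c ^ k * powerFourier c⁻¹ a k j l
      = fourier 1 ((j * l) • a) * powerFourier c a k (-l) j := by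
  induction k with
  | zero =>
    intro j l
    rw [powerFourier_zero, powerFourier_zero]
    by_cases hj : j = 0 <;> by_cases hl : l = 0 <;> simp [hj, hl]
  | succ k ih =>
    intro j l
    have f : ∀ p q : ℤ, (fourier 1 ((p + q) • a) : ℂ) = fourier 1 (p • a) * fourier 1 (q • a) := by
      intro p q; rw [add_smul, fourier_add_apply]
    have g : ∀ p : ℤ, (fourier (-1) (p • a) : ℂ) = fourier 1 ((-p) • a) := by
      intro p; rw [fourier_apply, fourier_apply]; simp
    rw [powerFourier_succ, powerFourier_succ]
    have h1 := ih (j - 1) l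
    have h2 := ih (j + 1) l
    have h3 := ih j (l - 1)
    have h4 := ih j (l + 1)
    have e1 : (j - 1) * l = j * l + -l := by ring
    have e2 : (j + 1) * l = j * l + l := by ring
    have e3 : j * (l - 1) = j * l + -j := by ring
    have e4 : j * (l + 1) = j * l + j := by ring
    have e5 : -(l - 1) = -l + 1 := by ring
    have e6 : -(l + 1) = -l - 1 := by ring
    rw [e1, f] at h1
    rw [e2, f] at h2
    rw [e3, f, e5] at h3
    rw [e4, f, e6] at h4
    rw [g, g, neg_neg]
    have hjj : (fourier 1 (j • a) : ℂ) * fourier 1 ((-j) • a) = 1 := by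
      rw [← f]; simp
    calc c ^ (k + 1) * (powerFourier c⁻¹ a k (j - 1) l + powerFourier c⁻¹ a k (j + 1) l
          + c⁻¹ * (fourier 1 (j • a) * powerFourier c⁻¹ a k j (l - 1)
          + fourier 1 ((-j) • a) * powerFourier c⁻¹ a k j (l + 1)))
        = c * (c ^ k * powerFourier c⁻¹ a k (j - 1) l) + c * (c ^ k * powerFourier c⁻¹ a k (j + 1) l)
          + (c * c⁻¹) * (fourier 1 (j • a) * (c ^ k * powerFourier c⁻¹ a k j (l - 1))
          + fourier 1 ((-j) • a) * (c ^ k * powerFourier c⁻¹ a k j (l + 1))) := by ring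
      _ = _ := by
        rw [h1, h2, h3, h4, mul_inv_cancel₀ hc]
        linear_combination (fourier 1 ((j * l) • a) * (powerFourier c a k (-l + 1) j
          + powerFourier c a k (-l - 1) j)) * hjj

lemma sum_jacobi_mul (w : ℕ → ℂ) (n : ℕ) (G : ℤ → ℂ) (h0 : G (-1) = 0) (hn : G n = 0)
    (i : Fin n) :
    ∑ j : Fin n, jacobi w n i j * G (j : ℕ) = G ((i : ℕ) - 1) + G ((i : ℕ) + 1) + w i * G (i : ℕ) := by
  obtain ⟨i, hi⟩ := i
  let g : ℕ → ℂ := fun j => (if i = j then w i * G (j : ℕ) else 0)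
    + (if i = j + 1 then G (j : ℕ) else 0) + (if i + 1 = j then G (j : ℕ) else 0)
  have e : ∀ j : Fin n, jacobi w n ⟨i, hi⟩ j * G (j : ℕ) = g j := by
    intro j
    simp only [jacobi, Matrix.of_apply, g]
    split_ifs <;> first | omega | simp
  simp only
  rw [Finset.sum_congr rfl fun j _ => e j, ← Finset.sum_range g]
  simp only [g]
  rw [Finset.sum_add_distrib, Finset.sum_add_distrib, Finset.sum_ite_eq, Finset.sum_ite_eq, if_pos (Finset.mem_range.2 hi)]
  have h1 : (∑ j ∈ Finset.range n, if i = j + 1 then G (j : ℕ) else 0) = G ((i : ℤ) - 1) := by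
    cases i with
    | zero => simpa using h0.symm
    | succ i =>
      simp only [Nat.add_right_cancel_iff]
      rw [Finset.sum_ite_eq, if_pos (Finset.mem_range.2 (by omega))]
      simp
  have h2 : (if i + 1 ∈ Finset.range n then G ((i + 1 : ℕ) : ℤ) else 0) = G ((i : ℤ) + 1) := by
    split_ifs with h
    · simp
    · have : n = i + 1 := by
        have := Finset.mem_range.not.1 h
        omega
      subst this
      rw [← hn]; simp
  rw [h1, h2]
  ring

/-- The almost Mathieu potential along the orbit of `x`. -/
def amPotential (c : ℂ) (a x : UnitAddCircle) (i : ℕ) : ℂ := c * cosSymbol (x + i • a)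

lemma jacobi_pow_apply (c : ℂ) (a x : UnitAddCircle) (n k : ℕ) (i : Fin n) (hi : k ≤ i)
    (hin : (i : ℕ) + k < n) : ∀ i' : Fin n,
      (jacobi (amPotential c a x) n ^ k) i' i
        = powerCoeff c a k ((i' : ℕ) - (i : ℕ)) (x + (i : ℕ) • a) := by
  induction k with
  | zero =>
    intro i'
    rw [pow_zero, Matrix.one_apply, powerCoeff]
    simp only [Fin.ext_iff, sub_eq_zero, Nat.cast_inj]
  | succ k ih =>
    intro i'
    have ih' := ih (by omega) (by omega)
    rw [pow_succ', Matrix.mul_apply]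
    simp only [ih']
    rw [sum_jacobi_mul (amPotential c a x) n
      (fun m => powerCoeff c a k (m - (i : ℕ)) (x + (i : ℕ) • a))]
    · rw [powerCoeff, amPotential]
      have e1 : ((i' : ℕ) : ℤ) - 1 - (i : ℕ) = (i' : ℕ) - (i : ℕ) - 1 := by ring
      have e2 : ((i' : ℕ) : ℤ) + 1 - (i : ℕ) = (i' : ℕ) - (i : ℕ) + 1 := by ring
      have e3 : x + (i : ℕ) • a + (((i' : ℕ) : ℤ) - (i : ℕ)) • a = x + (i' : ℕ) • a := by
        rw [sub_smul, natCast_zsmul, natCast_zsmul]; abel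
      rw [e1, e2, e3]
    · apply powerCoeff_eq_zero
      rw [abs_of_neg (by omega)]
      omega
    · apply powerCoeff_eq_zero
      rw [abs_of_pos (by omega)]
      omega

lemma norm_pow_jacobi_entry_le (c : ℂ) (a x : UnitAddCircle) (n k : ℕ) (i : Fin n) :
    ‖(jacobi (amPotential c a x) n ^ k) i i‖ ≤ (2 * ‖c‖ + 2) ^ k := by
  have : Nonempty (Fin n) := ⟨i⟩
  refine (norm_entry_le_norm _ i i).trans ((norm_pow_le _ k).trans ?_)
  gcongr
  refine norm_jacobi_le (fun i => ?_) n
  rw [amPotential, norm_mul, mul_comm]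
  gcongr
  exact norm_cosSymbol_le _

lemma card_boundary_le (n k : ℕ) :
    ((Finset.range n).filter fun i => ¬ (k ≤ i ∧ i + k < n)).card ≤ 2 * k := by
  have : ((Finset.range n).filter fun i => ¬ (k ≤ i ∧ i + k < n))
      ⊆ Finset.range k ∪ (Finset.Ico (n - k) n) := by
    intro i hi
    simp only [Finset.mem_filter, Finset.mem_range, Finset.mem_union, Finset.mem_Ico] at hi ⊢
    omega
  refine (Finset.card_le_card this).trans ((Finset.card_union_le _ _).trans ?_)
  simp
  omega

/-- Convergence of the moments of the density of states, with rate `O (1 / n)` uniformly in the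
phase. -/
lemma trace_jacobi_pow {a : UnitAddCircle} (ha : addOrderOf a = 0) (c : ℂ) (k : ℕ) :
    ∃ C : ℝ, ∀ (n : ℕ) (x : UnitAddCircle),
      ‖(jacobi (amPotential c a x) n ^ k).trace - n * powerFourier c a k 0 0‖ ≤ C := by
  obtain ⟨C, hC⟩ := (boundedDiscrepancy_powerCoeff ha c k 0).2 0
  refine ⟨(2 * k : ℕ) * (2 * (2 * ‖c‖ + 2) ^ k) + C, fun n x => ?_⟩
  have h := hC n x
  have hI : (∫ y, fourier 0 y * powerCoeff c a k 0 y ∂haarAddCircle) = powerFourier c a k 0 0 := by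
    rw [powerFourier, neg_zero]
  rw [hI] at h
  simp only [fourier_zero, one_mul] at h
  refine (norm_sub_le_norm_sub_add_norm_sub _
    (∑ i ∈ Finset.range n, powerCoeff c a k 0 (x + i • a)) _).trans (add_le_add ?_ h)
  · rw [Matrix.trace, Finset.sum_range, ← Finset.sum_sub_distrib]
    refine (norm_sum_le _ _).trans ?_
    have hle : ∀ i : Fin n, ‖(jacobi (amPotential c a x) n ^ k).diag i
        - powerCoeff c a k 0 (x + (i : ℕ) • a)‖
          ≤ (fun i : ℕ => if ¬ (k ≤ i ∧ i + k < n) then 2 * (2 * ‖c‖ + 2) ^ k else 0) i := by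
      intro i
      by_cases hi : k ≤ (i : ℕ) ∧ (i : ℕ) + k < n
      · rw [Matrix.diag_apply, jacobi_pow_apply c a x n k i hi.1 hi.2 i]
        simp [hi]
      · simp only [hi, not_false_eq_true, if_true]
        refine (norm_sub_le _ _).trans ?_
        rw [two_mul]
        exact add_le_add (norm_pow_jacobi_entry_le c a x n k i) (norm_powerCoeff_le c a _ k 0)
    refine (Finset.sum_le_sum fun i _ => hle i).trans ?_
    rw [← Finset.sum_range (fun i : ℕ => if ¬ (k ≤ i ∧ i + k < n) then 2 * (2 * ‖c‖ + 2) ^ k else 0),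
      ← Finset.sum_filter, Finset.sum_const, nsmul_eq_mul]
    gcongr
    exact card_boundary_le n k

lemma exists_spectrum_am (lam : ℝ) (a x : UnitAddCircle) (n : ℕ) :
    ∃ e : Fin n → ℝ, (∀ i, |e i| ≤ 2 * |lam| + 2) ∧
      (∀ z, prodSeq (fun i => stepMatrix z (amPotential lam a x i)) n 0 0 = ∏ i, (z - e i)) ∧
      ∀ k, (jacobi (amPotential lam a x) n ^ k).trace = ∑ i, (e i : ℂ) ^ k := by
  refine exists_spectrum_jacobi (fun i => ?_) (fun i => ?_) n
  · rw [amPotential, star_mul, star_cosSymbol, mul_comm]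
    simp
  · rw [amPotential, norm_mul, mul_comm, Complex.norm_real, Real.norm_eq_abs]
    gcongr
    exact norm_cosSymbol_le _

open Polynomial in
lemma eval_sum_eigenvalues {a : UnitAddCircle} (ha : addOrderOf a = 0) (c : ℂ) (b : ℝ)
    (p : ℝ[X]) : ∃ C : ℝ, ∀ (n : ℕ) (x : UnitAddCircle) (e : Fin n → ℝ),
      (∀ k, (jacobi (amPotential c a x) n ^ k).trace = ∑ i, (e i : ℂ) ^ k) →
      ‖((∑ i, p.eval (b * e i) : ℝ) : ℂ)
        - n * ∑ k ∈ p.support, (p.coeff k : ℂ) * (b ^ k * powerFourier c a k 0 0)‖ ≤ C := by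
  choose C hC using fun k => trace_jacobi_pow ha c k
  refine ⟨∑ k ∈ p.support, ‖(p.coeff k : ℂ)‖ * (‖(b : ℂ) ^ k‖ * C k), fun n x e he => ?_⟩
  have h : ((∑ i, p.eval (b * e i) : ℝ) : ℂ)
      = ∑ k ∈ p.support, (p.coeff k : ℂ) * (b ^ k * (jacobi (amPotential c a x) n ^ k).trace) := by
    simp only [he, Polynomial.eval_eq_sum, Polynomial.sum]
    push_cast
    rw [Finset.sum_comm]
    refine Finset.sum_congr rfl fun k _ => ?_
    rw [Finset.mul_sum, Finset.mul_sum]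
    refine Finset.sum_congr rfl fun i _ => ?_
    rw [mul_pow]
  rw [h, Finset.mul_sum, ← Finset.sum_sub_distrib]
  refine (norm_sum_le _ _).trans (Finset.sum_le_sum fun k _ => ?_)
  have e2 : (p.coeff k : ℂ) * (b ^ k * (jacobi (amPotential c a x) n ^ k).trace)
      - n * ((p.coeff k : ℂ) * (b ^ k * powerFourier c a k 0 0))
      = (p.coeff k : ℂ) * (b ^ k * ((jacobi (amPotential c a x) n ^ k).trace
        - n * powerFourier c a k 0 0)) := by ring
  rw [e2, norm_mul, norm_mul]
  gcongr
  exact hC k n x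

/-- Finite-volume Aubry duality: the determinants at coupling `lam` are controlled, uniformly in the
phase, by the regularized determinants at the dual coupling. -/
theorem entry_le_dual_entry {a : UnitAddCircle} (ha : addOrderOf a = 0) {lam : ℝ} (hlam : lam ≠ 0)
    (E : ℝ) {r ε : ℝ} (hr : r ≠ 0) (hε : 0 < ε) :
    ∃ N : ℕ, ∀ n m : ℕ, N ≤ n → N ≤ m → ∀ x y : UnitAddCircle,
      ‖prodSeq (fun i => stepMatrix E (amPotential lam a x i)) n 0 0‖ ≤
        Real.exp (n * (Real.log |lam| + Real.log ‖prodSeq (fun i => stepMatrix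
          ((E + r * Complex.I) / lam) (amPotential (lam⁻¹ : ℝ) a y i)) m 0 0‖ / m + ε)) := by
  set z : ℂ := E + r * Complex.I with hz
  have hzt : ∀ t : ℝ, z - t ≠ 0 := by
    intro t h
    have := congrArg Complex.im h
    simp [hz] at this
    exact hr this
  set f : ℝ → ℝ := fun t => Real.log ‖z - t‖ with hf
  have hfc : Continuous f := by
    refine Continuous.log (by fun_prop) fun t => ?_
    exact norm_ne_zero_iff.2 (hzt t)
  set R := 2 * |lam| + 2 with hR
  have hlam' : (lam : ℂ) ≠ 0 := by exact_mod_cast hlam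
  obtain ⟨p, hp⟩ := exists_polynomial_near_of_continuousOn (-R) R f hfc.continuousOn (ε / 4)
    (by positivity)
  have hp' : ∀ t : ℝ, |t| ≤ R → |p.eval t - f t| < ε / 4 := fun t ht => hp t (abs_le.1 ht)
  obtain ⟨C₁, hC₁⟩ := eval_sum_eigenvalues ha (lam : ℂ) 1 p
  obtain ⟨C₂, hC₂⟩ := eval_sum_eigenvalues ha ((lam⁻¹ : ℝ) : ℂ) lam p
  set τ : ℂ := ∑ k ∈ p.support, (p.coeff k : ℂ) * powerFourier lam a k 0 0 with hτ
  have hτ₁ : ∑ k ∈ p.support, (p.coeff k : ℂ) * (((1 : ℝ) : ℂ) ^ k * powerFourier lam a k 0 0)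
      = τ := by simp [hτ]
  have hτ₂ : ∑ k ∈ p.support, (p.coeff k : ℂ)
      * ((lam : ℂ) ^ k * powerFourier ((lam⁻¹ : ℝ) : ℂ) a k 0 0) = τ := by
    refine Finset.sum_congr rfl fun k _ => ?_
    have := powerFourier_duality hlam' a k 0 0
    rw [Complex.ofReal_inv, this]
    simp
  rw [hτ₁] at hC₁
  rw [hτ₂] at hC₂
  obtain ⟨N, hN⟩ := exists_nat_gt (max (max C₁ C₂ / (ε / 4)) 0)
  refine ⟨N, fun n m hn hm x y => ?_⟩
  have hN0 : (0 : ℝ) < N := (le_max_right _ _).trans_lt hN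
  have hn0 : (0 : ℝ) < n := hN0.trans_le (by exact_mod_cast hn)
  have hm0 : (0 : ℝ) < m := hN0.trans_le (by exact_mod_cast hm)
  have hNC : max C₁ C₂ ≤ N * (ε / 4) := by
    have := (le_max_left _ _).trans_lt hN
    rw [div_lt_iff₀ (by positivity)] at this
    exact this.le
  have hC₁n : C₁ ≤ n * (ε / 4) := (le_max_left _ _).trans (hNC.trans (by gcongr))
  have hC₂m : C₂ ≤ m * (ε / 4) := (le_max_right _ _).trans (hNC.trans (by gcongr))
  obtain ⟨e, heR, hdet, htr⟩ := exists_spectrum_am lam a x n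
  obtain ⟨e', heR', hdet', htr'⟩ := exists_spectrum_am lam⁻¹ a y m
  have k₁ := (Complex.abs_re_le_norm _).trans (hC₁ n x e htr)
  have k₂ := (Complex.abs_re_le_norm _).trans (hC₂ m y e' htr')
  have hre : ∀ n : ℕ, ((n : ℂ) * τ).re = n * τ.re := by simp
  simp only [Complex.sub_re, Complex.ofReal_re, hre, one_mul] at k₁ k₂
  have k₁' := (abs_le.1 k₁).2
  have k₂' := (abs_le.1 k₂).1
  rw [hdet, hdet', norm_prod, norm_prod]
  have s₁ : ∏ i, ‖(E : ℂ) - e i‖ ≤ Real.exp (∑ i, f (e i)) := by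
    rw [Real.exp_sum]
    refine Finset.prod_le_prod (fun _ _ => norm_nonneg _) fun i _ => ?_
    rw [hf, Real.exp_log (norm_pos_iff.2 (hzt _))]
    have h1 : ‖(E : ℂ) - e i‖ = |(z - e i).re| := by
      rw [← Complex.ofReal_sub, Complex.norm_real, Real.norm_eq_abs]
      simp [hz]
    rw [h1]
    exact Complex.abs_re_le_norm _
  refine s₁.trans (Real.exp_le_exp.2 ?_)
  have s₂ : ∑ i, f (e i) ≤ ∑ i, p.eval (e i) + n * (ε / 4) := by
    have : ∑ i, f (e i) ≤ ∑ i : Fin n, (p.eval (e i) + ε / 4) := by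
      refine Finset.sum_le_sum fun i _ => ?_
      have := (abs_lt.1 (hp' (e i) (heR i))).1
      linarith
    simpa [Finset.sum_add_distrib] using this
  have s₃ : Real.log (∏ i, ‖z / lam - e' i‖) = ∑ i, f (lam * e' i) - m * Real.log |lam| := by
    have e3 : ∀ i, ‖z / lam - e' i‖ = ‖z - (lam * e' i : ℝ)‖ / |lam| := by
      intro i
      rw [← Real.norm_eq_abs, ← Complex.norm_real, ← norm_div]
      congr 1
      push_cast
      field_simp
    rw [Real.log_prod]
    · have : ∀ i, Real.log (‖z - (lam * e' i : ℝ)‖ / |lam|) = f (lam * e' i) - Real.log |lam| :=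
        fun i => Real.log_div (norm_ne_zero_iff.2 (hzt _)) (abs_ne_zero.2 hlam)
      simp only [e3, this, Finset.sum_sub_distrib, Finset.sum_const, Finset.card_univ, Fintype.card_fin,
        nsmul_eq_mul]
    · intro i _
      rw [e3]
      exact div_ne_zero (norm_ne_zero_iff.2 (hzt _)) (abs_ne_zero.2 hlam)
  have s₄ : ∑ i, p.eval (lam * e' i) ≤ ∑ i, f (lam * e' i) + m * (ε / 4) := by
    have : ∑ i, p.eval (lam * e' i) ≤ ∑ i : Fin m, (f (lam * e' i) + ε / 4) := by
      refine Finset.sum_le_sum fun i _ => ?_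
      have hle : |lam * e' i| ≤ R := by
        rw [abs_mul]
        have := mul_le_mul_of_nonneg_left (heR' i) (abs_nonneg lam)
        refine this.trans (le_of_eq ?_)
        rw [abs_inv]
        have : |lam| ≠ 0 := abs_ne_zero.2 hlam
        field_simp
        ring
      have := (abs_lt.1 (hp' _ hle)).2
      linarith
    simpa [Finset.sum_add_distrib] using this
  rw [s₃]
  have s₅ : τ.re ≤ (∑ i, f (lam * e' i)) / m + ε / 2 := by
    have : m * τ.re ≤ ∑ i, f (lam * e' i) + m * (ε / 2) := by linarith
    rw [← sub_le_iff_le_add, le_div_iff₀ hm0]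
    linarith
  have s₆ : (∑ i, f (lam * e' i) - m * Real.log |lam|) / m
      = (∑ i, f (lam * e' i)) / m - Real.log |lam| := by
    field_simp
  rw [s₆]
  have s₇ := mul_le_mul_of_nonneg_left s₅ hn0.le
  linarith

/-- The area form on `ℂ²`. -/
def wedge (v w : Fin 2 → ℂ) : ℂ := v 0 * w 1 - v 1 * w 0

/-- The vector orthogonal to `v` with `wedge v (perp v) = 1`. -/
def perp (v : Fin 2 → ℂ) : Fin 2 → ℂ :=
  ((‖v 0‖ ^ 2 + ‖v 1‖ ^ 2 : ℝ) : ℂ)⁻¹ • ![-star (v 1), star (v 0)]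

lemma norm_wedge_le (v w : Fin 2 → ℂ) : ‖wedge v w‖ ≤ 2 * (‖v‖ * ‖w‖) := by
  have h : ∀ i j, ‖v i * w j‖ ≤ ‖v‖ * ‖w‖ := fun i j => by
    rw [norm_mul]
    exact mul_le_mul (norm_le_pi_norm v i) (norm_le_pi_norm w j) (norm_nonneg _) (norm_nonneg _)
  refine (norm_sub_le _ _).trans ?_
  linarith [h 0 1, h 1 0]

lemma sq_norm_le_sum_sq (v : Fin 2 → ℂ) : ‖v‖ ^ 2 ≤ ‖v 0‖ ^ 2 + ‖v 1‖ ^ 2 := by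
  have h : ‖v‖ ≤ √(‖v 0‖ ^ 2 + ‖v 1‖ ^ 2) := by
    refine (pi_norm_le_iff_of_nonneg (Real.sqrt_nonneg _)).2 fun i => Real.le_sqrt_of_sq_le ?_
    fin_cases i <;> simp
  calc ‖v‖ ^ 2 ≤ √(‖v 0‖ ^ 2 + ‖v 1‖ ^ 2) ^ 2 := by gcongr
    _ = _ := Real.sq_sqrt (by positivity)

lemma wedge_perp {v : Fin 2 → ℂ} (hv : v ≠ 0) : wedge v (perp v) = 1 := by
  have h0 : 0 < ‖v 0‖ ^ 2 + ‖v 1‖ ^ 2 :=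
    (pow_pos (norm_pos_iff.2 hv) 2).trans_le (sq_norm_le_sum_sq v)
  have h1 : ((‖v 0‖ ^ 2 + ‖v 1‖ ^ 2 : ℝ) : ℂ) ≠ 0 := by exact_mod_cast h0.ne'
  have h2 : v 0 * star (v 0) + v 1 * star (v 1) = ((‖v 0‖ ^ 2 + ‖v 1‖ ^ 2 : ℝ) : ℂ) := by
    simp [Complex.mul_conj, Complex.normSq_eq_norm_sq]
  simp only [wedge, perp, Pi.smul_apply, smul_eq_mul, Matrix.cons_val_zero, Matrix.cons_val_one]
  rw [← mul_inv_cancel₀ h1]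
  nth_rewrite 3 [← h2]
  ring

lemma norm_perp_le (v : Fin 2 → ℂ) : ‖perp v‖ ≤ ‖v‖⁻¹ := by
  rcases eq_or_ne v 0 with rfl | hv
  · simp [perp]
  have hp := norm_pos_iff.2 hv
  have hn : ‖(![-star (v 1), star (v 0)] : Fin 2 → ℂ)‖ ≤ ‖v‖ := by
    refine (pi_norm_le_iff_of_nonneg hp.le).2 fun i => ?_
    fin_cases i
    · simpa using norm_le_pi_norm v 1
    · simpa using norm_le_pi_norm v 0
  rw [perp, norm_smul, norm_inv, Complex.norm_real, Real.norm_of_nonneg (by positivity)]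
  calc _ ≤ (‖v‖ ^ 2)⁻¹ * ‖v‖ := by
        gcongr
        exact sq_norm_le_sum_sq v
    _ = ‖v‖⁻¹ := by field_simp

lemma eq_wedge_smul_add {v w : Fin 2 → ℂ} (h : wedge v w = 1) (x : Fin 2 → ℂ) :
    x = wedge x w • v + wedge v x • w := by
  have h' : v 0 * w 1 - v 1 * w 0 = 1 := h
  funext i
  fin_cases i
  · simp only [wedge, Pi.add_apply, Pi.smul_apply, smul_eq_mul, Fin.zero_eta]
    linear_combination -(x 0) * h'
  · simp only [wedge, Pi.add_apply, Pi.smul_apply, smul_eq_mul, Fin.mk_one]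
    linear_combination -(x 1) * h'

lemma wedge_mulVec (T : Matrix (Fin 2) (Fin 2) ℂ) (v w : Fin 2 → ℂ) :
    wedge (T *ᵥ v) (T *ᵥ w) = T.det * wedge v w := by
  simp [wedge, Matrix.mulVec, dotProduct, Fin.sum_univ_two, Matrix.det_fin_two]
  ring

/-- A cocycle step maps `perp v` to `perp (T v)` up to a controlled multiple of `T v`. -/
lemma mulVec_perp {T : Matrix (Fin 2) (Fin 2) ℂ} (hT : T.det = 1) {v : Fin 2 → ℂ} (hv : v ≠ 0)
    {M c : ℝ} (hM : ‖T‖ ≤ M) (hc : 0 < c) (hv' : c ≤ ‖v‖) (hTv : c ≤ ‖T *ᵥ v‖) :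
    ∃ t : ℂ, ‖t‖ ≤ 2 * M / c ^ 2 ∧ T *ᵥ perp v = perp (T *ᵥ v) + t • (T *ᵥ v) := by
  have hTv0 : T *ᵥ v ≠ 0 := norm_pos_iff.1 (hc.trans_le hTv)
  refine ⟨wedge (T *ᵥ perp v) (perp (T *ᵥ v)), ?_, ?_⟩
  · refine (norm_wedge_le _ _).trans ?_
    have h1 : ‖T *ᵥ perp v‖ ≤ M * c⁻¹ := by
      refine (Matrix.linfty_opNorm_mulVec T _).trans ?_
      have h3 : ‖perp v‖ ≤ c⁻¹ := (norm_perp_le v).trans (inv_anti₀ hc hv')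
      gcongr
      exact (norm_nonneg _).trans hM
    have h2 : ‖perp (T *ᵥ v)‖ ≤ c⁻¹ := (norm_perp_le _).trans (inv_anti₀ hc hTv)
    calc _ ≤ 2 * ((M * c⁻¹) * c⁻¹) := by gcongr; exact (norm_nonneg _).trans h1
      _ = _ := by field_simp
  · conv_lhs => rw [eq_wedge_smul_add (wedge_perp hTv0) (T *ᵥ perp v)]
    rw [wedge_mulVec, hT, wedge_perp hv, one_mul, one_smul, add_comm]

lemma norm_prodSeq_le_of_orbit {T : ℕ → Matrix (Fin 2) (Fin 2) ℂ} (hT : ∀ i, (T i).det = 1)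
    {M : ℝ} (hM : ∀ i, ‖T i‖ ≤ M) {v : ℕ → Fin 2 → ℂ} (hv : ∀ i, T i *ᵥ v i = v (i + 1))
    {N : ℕ} {c K : ℝ} (hc : 0 < c) (hcv : ∀ i, i ≤ N → c ≤ ‖v i‖) (h0 : ‖v 0‖ ≤ K)
    (hN : ‖v N‖ ≤ K) : ‖prodSeq T N‖ ≤ 8 * K / c + 8 * M * N * K ^ 2 / c ^ 2 := by
  have hK : 0 ≤ K := (norm_nonneg _).trans h0
  have hM0 : 0 ≤ M := (norm_nonneg _).trans (hM 0)
  have hvn : ∀ n, prodSeq T n *ᵥ v 0 = v n := by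
    intro n
    induction n with
    | zero => simp
    | succ n ih => rw [prodSeq_succ, ← Matrix.mulVec_mulVec, ih, hv]
  have key : ∀ n, n ≤ N → ∃ s : ℂ, ‖s‖ ≤ n * (2 * M / c ^ 2) ∧
      prodSeq T n *ᵥ perp (v 0) = perp (v n) + s • v n := by
    intro n
    induction n with
    | zero => exact fun _ => ⟨0, by simp⟩
    | succ n ih =>
      intro hn
      obtain ⟨s, hs, hs'⟩ := ih (by omega)
      have hn1 := hcv n (by omega)
      have hn2 := hcv (n + 1) hn
      rw [← hv] at hn2
      obtain ⟨t, ht, ht'⟩ := mulVec_perp (hT n) (norm_pos_iff.1 (hc.trans_le hn1)) (hM n) hc hn1 hn2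
      refine ⟨t + s, ?_, ?_⟩
      · refine (norm_add_le _ _).trans ?_
        push_cast
        linarith
      · rw [prodSeq_succ, ← Matrix.mulVec_mulVec, hs', Matrix.mulVec_add, ht', Matrix.mulVec_smul,
          hv, add_smul, add_assoc]
  obtain ⟨s, hs, hs'⟩ := key N le_rfl
  have hv0 : v 0 ≠ 0 := norm_pos_iff.1 (hc.trans_le (hcv 0 (Nat.zero_le _)))
  have hp0 : ‖perp (v 0)‖ ≤ c⁻¹ :=
    (norm_perp_le _).trans (inv_anti₀ hc (hcv 0 (Nat.zero_le _)))
  have hpN : ‖perp (v N)‖ ≤ c⁻¹ := (norm_perp_le _).trans (inv_anti₀ hc (hcv N le_rfl))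
  have hw : ‖prodSeq T N *ᵥ perp (v 0)‖ ≤ c⁻¹ + N * (2 * M / c ^ 2) * K := by
    rw [hs']
    refine (norm_add_le _ _).trans ?_
    rw [norm_smul]
    gcongr
  have hx : ∀ x : Fin 2 → ℂ, ‖x‖ ≤ 1 → ‖prodSeq T N *ᵥ x‖
      ≤ 2 * (1 * c⁻¹) * K + 2 * (K * 1) * (c⁻¹ + N * (2 * M / c ^ 2) * K) := by
    intro x hx
    rw [eq_wedge_smul_add (wedge_perp hv0) x, Matrix.mulVec_add, Matrix.mulVec_smul,
      Matrix.mulVec_smul, hvn]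
    refine (norm_add_le _ _).trans ?_
    rw [norm_smul, norm_smul]
    have h1 : ‖wedge x (perp (v 0))‖ ≤ 2 * (1 * c⁻¹) :=
      (norm_wedge_le _ _).trans (by gcongr)
    have h2 : ‖wedge (v 0) x‖ ≤ 2 * (K * 1) :=
      (norm_wedge_le _ _).trans (by gcongr)
    gcongr
  have he : ∀ i j, ‖prodSeq T N i j‖
      ≤ 2 * (1 * c⁻¹) * K + 2 * (K * 1) * (c⁻¹ + N * (2 * M / c ^ 2) * K) := by
    intro i j
    have h := hx (Pi.single j 1) (by rw [Pi.norm_single, norm_one])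
    rw [Matrix.mulVec_single_one] at h
    exact (norm_le_pi_norm ((prodSeq T N).col j) i).trans h
  refine (norm_le_two_mul he).trans (le_of_eq ?_)
  field_simp
  ring

lemma haarAddCircle_eq_volume : (haarAddCircle : Measure UnitAddCircle) = volume := by
  rw [volume_eq_smul_haarAddCircle, ENNReal.ofReal_one, one_smul]

lemma ae_add_nsmul (a : UnitAddCircle) {p : UnitAddCircle → Prop}
    (h : ∀ᵐ x ∂haarAddCircle, p x) : ∀ᵐ x ∂haarAddCircle, ∀ n : ℕ, p (x + n • a) := by
  refine ae_all_iff.2 fun n => ?_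
  exact (measurePreserving_add_right haarAddCircle (n • a)).quasiMeasurePreserving.ae h

/-- A nonzero equivariant section of an invertible cocycle over an irrational rotation vanishes
almost nowhere. -/
lemma ae_ne_zero_of_equivariant {a : UnitAddCircle} (ha : addOrderOf a = 0)
    {T : UnitAddCircle → Matrix (Fin 2) (Fin 2) ℂ} (hdet : ∀ x, (T x).det = 1)
    {ω : ℂ} (hω : ω ≠ 0) {Ψ : UnitAddCircle → Fin 2 → ℂ} (hΨ : Measurable Ψ)
    (hΨ0 : ¬ ∀ᵐ x ∂haarAddCircle, Ψ x = 0)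
    (heq : ∀ᵐ x ∂haarAddCircle, T x *ᵥ Ψ x = ω • Ψ (x + a)) :
    ∀ᵐ x ∂haarAddCircle, Ψ x ≠ 0 := by
  have hs : MeasurableSet {x | Ψ x = 0} := hΨ (measurableSet_singleton 0)
  have herg : Ergodic (fun x : UnitAddCircle => x + a) haarAddCircle := by
    rw [haarAddCircle_eq_volume]
    exact AddCircle.ergodic_add_right.2 ha
  have hinv : (fun x : UnitAddCircle => x + a) ⁻¹' {x | Ψ x = 0} =ᵐ[haarAddCircle]
      {x | Ψ x = 0} := by
    filter_upwards [heq] with x hx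
    refine propext ⟨fun h => ?_, fun h => ?_⟩
    · have h' : Ψ (x + a) = 0 := h
      rw [h', smul_zero] at hx
      exact Matrix.eq_zero_of_mulVec_eq_zero (by rw [hdet]; exact one_ne_zero) hx
    · have h' : Ψ x = 0 := h
      rw [h', Matrix.mulVec_zero] at hx
      exact (smul_eq_zero.1 hx.symm).resolve_left hω
  rcases herg.quasiErgodic.ae_empty_or_univ₀ hs.nullMeasurableSet hinv with h | h
  · filter_upwards [h] with x hx h0
    have : (∅ : Set UnitAddCircle) x := by rw [← hx]; exact h0
    exact this
  · refine (hΨ0 ?_).elim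
    filter_upwards [h] with x hx
    have : {x | Ψ x = 0} x := by rw [hx]; trivial
    exact this

lemma exists_measure_norm_le {Ψ : UnitAddCircle → Fin 2 → ℂ} (hΨ : Measurable Ψ)
    (hΨ0 : ∀ᵐ x ∂haarAddCircle, Ψ x ≠ 0) {κ : ℝ} (hκ : 0 < κ) :
    ∃ K : ℝ, 1 ≤ K ∧ MeasurableSet {x | ¬ (K⁻¹ ≤ ‖Ψ x‖ ∧ ‖Ψ x‖ ≤ K)} ∧
      haarAddCircle.real {x | ¬ (K⁻¹ ≤ ‖Ψ x‖ ∧ ‖Ψ x‖ ≤ K)} < κ := by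
  set s : ℕ → Set UnitAddCircle := fun n =>
    {x | ¬ (((n : ℝ) + 1)⁻¹ ≤ ‖Ψ x‖ ∧ ‖Ψ x‖ ≤ (n : ℝ) + 1)} with hs
  have hm : ∀ n, MeasurableSet (s n) := fun n =>
    ((measurableSet_le measurable_const hΨ.norm).inter
      (measurableSet_le hΨ.norm measurable_const)).compl
  have hanti : Antitone s := by
    intro m n hmn x hx h
    refine hx ⟨le_trans ?_ h.1, h.2.trans ?_⟩ <;> gcongr
  have hlim := tendsto_measure_iInter_atTop (μ := haarAddCircle)
    (fun n => (hm n).nullMeasurableSet) hanti ⟨0, measure_ne_top _ _⟩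
  have hzero : haarAddCircle (⋂ n, s n) = 0 := by
    refine measure_mono_null (fun x hx => ?_) (ae_iff.1 hΨ0)
    simp only [Set.mem_ofPred_eq, not_not]
    by_contra h0
    have hp := norm_pos_iff.2 h0
    obtain ⟨n, hn⟩ := exists_nat_ge (max ‖Ψ x‖ ‖Ψ x‖⁻¹)
    have h1 : ‖Ψ x‖ ≤ n := (le_max_left _ _).trans hn
    have h2 : ‖Ψ x‖⁻¹ ≤ n := (le_max_right _ _).trans hn
    refine Set.mem_iInter.1 hx n ⟨?_, by linarith⟩
    exact inv_le_of_inv_le₀ hp (by linarith)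
  rw [hzero] at hlim
  have hlt := (tendsto_order.1 hlim).2 (ENNReal.ofReal κ) (by simpa using hκ)
  obtain ⟨n, hn⟩ := hlt.exists
  refine ⟨n + 1, by linarith [(Nat.cast_nonneg n : (0 : ℝ) ≤ n)], hm n, ?_⟩
  rw [Measure.real]
  exact (ENNReal.toReal_lt_of_lt_ofReal hn)

lemma norm_iterate_le {T : ℕ → Matrix (Fin 2) (Fin 2) ℂ} {M : ℝ} (hM1 : 1 ≤ M)
    (hM : ∀ i, ‖T i‖ ≤ M) {v : ℕ → Fin 2 → ℂ} (hv : ∀ i, T i *ᵥ v i = v (i + 1)) (i m : ℕ) :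
    ‖v (i + m)‖ ≤ M ^ m * ‖v i‖ := by
  induction m with
  | zero => simp
  | succ m ih =>
    rw [← add_assoc, ← hv, pow_succ', mul_assoc]
    refine (Matrix.linfty_opNorm_mulVec _ _).trans ?_
    gcongr
    exact hM _

/-- Growth along an orbit that is balanced at the checkpoints `i * m`. -/
lemma norm_prodSeq_le_of_checkpoints {T : ℕ → Matrix (Fin 2) (Fin 2) ℂ}
    (hT : ∀ i, (T i).det = 1) {M : ℝ} (hM1 : 1 ≤ M) (hM : ∀ i, ‖T i‖ ≤ M) {v : ℕ → Fin 2 → ℂ}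
    (hv : ∀ i, T i *ᵥ v i = v (i + 1)) {L m : ℕ} (hm : 1 ≤ m) (hL : 1 ≤ L) {K : ℝ} (hK : 1 ≤ K)
    (hG : ∀ i, i ≤ L → K⁻¹ ≤ ‖v (i * m)‖ ∧ ‖v (i * m)‖ ≤ K) :
    ‖prodSeq T (L * m)‖ ≤ 16 * M * K ^ 4 * (L * m : ℕ) * M ^ (2 * m) := by
  have hM0 : 0 < M := by linarith
  have hK0 : 0 < K := by linarith
  set c := (K * M ^ m)⁻¹ with hc
  have hc0 : 0 < c := by positivity
  have hlow : ∀ i, i ≤ L * m → c ≤ ‖v i‖ := by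
    intro i hi
    obtain ⟨q, r, hr, hq, hir⟩ : ∃ q r : ℕ, r ≤ m ∧ q ≤ L ∧ i + r = q * m := by
      rcases Nat.eq_zero_or_pos (i % m) with h0 | h0
      · refine ⟨i / m, 0, by omega, Nat.div_le_of_le_mul (by rwa [mul_comm]), ?_⟩
        have := Nat.div_add_mod i m
        rw [mul_comm] at this
        omega
      · have hlt : i % m < m := Nat.mod_lt _ hm
        have h1 := Nat.div_add_mod i m
        refine ⟨i / m + 1, m - i % m, by omega, ?_, ?_⟩
        · by_contra h
          have : L ≤ i / m := by omega
          have := Nat.mul_le_mul_left m this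
          rw [mul_comm m L] at this
          omega
        · rw [add_mul, one_mul, mul_comm]
          omega
    have h1 := (hG q hq).1
    have h2 := norm_iterate_le hM1 hM hv i r
    rw [hir] at h2
    have h3 : M ^ r ≤ M ^ m := pow_le_pow_right₀ hM1 hr
    have h4 : K⁻¹ ≤ M ^ m * ‖v i‖ := h1.trans (h2.trans (by gcongr))
    rw [hc, mul_inv, ← div_eq_mul_inv, div_le_iff₀ (by positivity), mul_comm]
    exact h4
  have h0 := (hG 0 (Nat.zero_le _)).2
  rw [zero_mul] at h0
  refine (norm_prodSeq_le_of_orbit hT hM hv hc0 hlow h0 (hG L le_rfl).2).trans ?_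
  have hN : (1 : ℝ) ≤ (L * m : ℕ) := by exact_mod_cast Nat.mul_pos hL hm
  set n : ℝ := ((L * m : ℕ) : ℝ)
  have e1 : 8 * K / c = 8 * (1 * K ^ 2 * 1 * M ^ m) := by
    rw [hc]; field_simp
  have e2 : 8 * M * n * K ^ 2 / c ^ 2 = 8 * (M * K ^ 4 * n * M ^ (2 * m)) := by
    rw [hc]; field_simp; ring
  have h5 : 1 * K ^ 2 * 1 * M ^ m ≤ M * K ^ 4 * n * M ^ (2 * m) := by
    gcongr
    · norm_num
    · omega
  rw [e1, e2]
  linarith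

/-- The existence of a nonzero measurable equivariant section forces subexponential growth in
mean. -/
theorem exists_integral_log_norm_le {a : UnitAddCircle} (ha : addOrderOf a = 0)
    {T : UnitAddCircle → Matrix (Fin 2) (Fin 2) ℂ} (hdet : ∀ x, (T x).det = 1)
    {M : ℝ} (hM : ∀ x, ‖T x‖ ≤ M)
    {ω : ℂ} (hω : ‖ω‖ = 1) {Ψ : UnitAddCircle → Fin 2 → ℂ} (hΨ : Measurable Ψ)
    (hΨ0 : ¬ ∀ᵐ x ∂haarAddCircle, Ψ x = 0)
    (heq : ∀ᵐ x ∂haarAddCircle, T x *ᵥ Ψ x = ω • Ψ (x + a)) {ε : ℝ} (hε : 0 < ε) :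
    ∃ N : ℕ, 1 ≤ N ∧
      ∫ x, Real.log ‖prodSeq (fun i => T (x + i • a)) N‖ ∂haarAddCircle ≤ ε * N := by
  have hω0 : ω ≠ 0 := norm_pos_iff.1 (by rw [hω]; norm_num)
  have hM1 : 1 ≤ M := (one_le_norm_of_det_eq_one (hdet 0)).trans (hM 0)
  have hlM : 0 ≤ Real.log M := Real.log_nonneg hM1
  obtain ⟨L, hL⟩ := exists_nat_gt (max (8 * Real.log M / ε) 0)
  have hL0 : (0 : ℝ) < L := (le_max_right _ _).trans_lt hL
  have hL1 : 1 ≤ L := by exact_mod_cast hL0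
  have hLM : 8 * Real.log M ≤ ε * L := by
    have := ((le_max_left _ _).trans_lt hL).le
    rw [div_le_iff₀ hε] at this
    linarith
  set κ := ε / (2 * (L + 1) * (Real.log M + 1)) with hκ
  obtain ⟨K, hK1, hKm, hKκ⟩ := exists_measure_norm_le hΨ
    (ae_ne_zero_of_equivariant ha hdet hω0 hΨ hΨ0 heq) (κ := κ) (by positivity)
  set B := {x | ¬ (K⁻¹ ≤ ‖Ψ x‖ ∧ ‖Ψ x‖ ≤ K)} with hB
  obtain ⟨m, hm1, hmb⟩ : ∃ m : ℕ, 1 ≤ m ∧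
      Real.log (16 * M * K ^ 4) + Real.log (L * m : ℕ) ≤ ε / 4 * (L * m : ℕ) := by
    have h1 : Tendsto (fun m : ℕ => ((L * m : ℕ) : ℝ)) atTop atTop :=
      tendsto_natCast_atTop_atTop.comp (tendsto_id.const_mul_atTop' hL1)
    have h2 : ∀ᶠ y : ℝ in atTop, Real.log (16 * M * K ^ 4) + Real.log y ≤ ε / 4 * y := by
      have h3 := (Real.isLittleO_log_id_atTop.def (c := ε / 8) (by positivity))
      filter_upwards [h3, eventually_ge_atTop (Real.log (16 * M * K ^ 4) / (ε / 8)),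
        eventually_ge_atTop 1] with y hy hy2 hy3
      rw [div_le_iff₀ (by positivity)] at hy2
      have hy4 := (Real.le_norm_self _).trans hy
      rw [id, Real.norm_of_nonneg (by linarith)] at hy4
      linarith
    obtain ⟨m, hm⟩ := ((h1.eventually h2).and (eventually_ge_atTop 1)).exists
    exact ⟨m, hm.2, hm.1⟩
  set N := L * m with hN
  have hN1 : 1 ≤ N := Nat.mul_pos hL1 hm1
  have hN1' : (1 : ℝ) ≤ N := by exact_mod_cast hN1
  refine ⟨N, hN1, ?_⟩
  set U := ⋃ i ∈ Finset.range (L + 1), (fun x : UnitAddCircle => x + (i * m) • a) ⁻¹' B with hU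
  have hUm : MeasurableSet U := Finset.measurableSet_biUnion _ fun i _ =>
    (measurable_add_const _) hKm
  have hUμ : haarAddCircle.real U ≤ (L + 1) * κ := by
    refine (measureReal_biUnion_finset_le _ _).trans ?_
    have : ∀ i ∈ Finset.range (L + 1), haarAddCircle.real
        ((fun x : UnitAddCircle => x + (i * m) • a) ⁻¹' B) ≤ κ := by
      intro i _
      rw [measureReal_def, (measurePreserving_add_right haarAddCircle ((i * m) • a)).measure_preimage
        hKm.nullMeasurableSet]
      exact hKκ.le
    refine (Finset.sum_le_sum this).trans ?_
    simp
  have hnn : ∀ x, 0 ≤ Real.log ‖prodSeq (fun i => T (x + i • a)) N‖ := fun x =>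
    Real.log_nonneg (one_le_norm_of_det_eq_one (det_prodSeq _ (fun _ => hdet _) _))
  have hpos : ∀ x, 0 < ‖prodSeq (fun i => T (x + i • a)) N‖ := fun x =>
    zero_lt_one.trans_le (one_le_norm_of_det_eq_one (det_prodSeq _ (fun _ => hdet _) _))
  have hbound : ∀ᵐ x ∂haarAddCircle, Real.log ‖prodSeq (fun i => T (x + i • a)) N‖
      ≤ ε / 2 * N + U.indicator (fun _ => N * Real.log M) x := by
    filter_upwards [ae_add_nsmul a heq] with x hx
    by_cases hxU : x ∈ U
    · rw [Set.indicator_of_mem hxU]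
      have := Real.log_le_log (hpos x) (norm_prodSeq_le (fun i => hM (x + i • a)) N)
      rw [Real.log_pow] at this
      have h0 : 0 ≤ ε / 2 * N := by positivity
      linarith
    · rw [Set.indicator_of_notMem hxU, add_zero]
      have hG : ∀ i, i ≤ L → K⁻¹ ≤ ‖ω ^ (i * m) • Ψ (x + (i * m) • a)‖ ∧
          ‖ω ^ (i * m) • Ψ (x + (i * m) • a)‖ ≤ K := by
        intro i hi
        rw [norm_smul, norm_pow, hω, one_pow, one_mul]
        by_contra h
        exact hxU (Set.mem_biUnion (Finset.mem_coe.2 (Finset.mem_range.2 (by omega))) h)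
      have hv : ∀ i : ℕ, T (x + i • a) *ᵥ (ω ^ i • Ψ (x + i • a))
          = ω ^ (i + 1) • Ψ (x + (i + 1) • a) := by
        intro i
        rw [Matrix.mulVec_smul, hx i, smul_smul, ← pow_succ, add_smul, one_smul, add_assoc]
      have h1 := norm_prodSeq_le_of_checkpoints (T := fun i => T (x + i • a)) (fun _ => hdet _) hM1
        (fun i => hM _) (v := fun i => ω ^ i • Ψ (x + i • a)) hv hm1 hL1 hK1 hG
      have h2 := Real.log_le_log (hpos x) h1
      rw [Real.log_mul (by positivity) (by positivity), Real.log_mul (by positivity) (by positivity),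
        Real.log_pow] at h2
      have h3 : ((2 * m : ℕ) : ℝ) * Real.log M ≤ ε / 4 * N := by
        rw [hN]
        push_cast
        have : (0 : ℝ) ≤ m := Nat.cast_nonneg _
        nlinarith
      linarith
  have hint : Integrable (fun x => ε / 2 * N + U.indicator (fun _ => N * Real.log M) x)
      haarAddCircle :=
    (integrable_const _).add ((integrable_const _).indicator hUm)
  refine (integral_mono_of_nonneg (ae_of_all _ hnn) hint hbound).trans ?_
  rw [integral_add (integrable_const _) ((integrable_const _).indicator hUm), integral_const,
    integral_indicator_const _ hUm]
  simp only [probReal_univ, smul_eq_mul]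
  have h4 : haarAddCircle.real U * (N * Real.log M) ≤ (L + 1) * κ * (N * (Real.log M + 1)) := by
    gcongr
    linarith
  have h5 : (L + 1) * κ * (N * (Real.log M + 1)) = ε / 2 * N := by
    rw [hκ]
    have : Real.log M + 1 ≠ 0 := by positivity
    field_simp
  linarith

lemma fourierCoeff_comp_add_right (f : UnitAddCircle → ℂ) (a : UnitAddCircle) (k : ℤ) :
    fourierCoeff (fun x => f (x + a)) k = fourier k a * fourierCoeff f k := by
  have h := integral_add_right_eq_self (μ := (haarAddCircle : Measure UnitAddCircle))
    (fun x => (fourier (-k) x : ℂ) * f x) a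
  simp only [fourierCoeff, smul_eq_mul]
  rw [← h, ← integral_const_mul]
  refine integral_congr_ae (ae_of_all _ fun x => ?_)
  have e : (fourier k a : ℂ) * fourier (-k) a = 1 := by
    rw [← fourier_add, add_neg_cancel, fourier_zero]
  simp only [fourier_add_apply]
  linear_combination (-(fourier (-k) x * f (x + a)) : ℂ) * e

lemma fourierCoeff_fourier_mul (f : UnitAddCircle → ℂ) (m k : ℤ) :
    fourierCoeff (fun x => fourier m x * f x) k = fourierCoeff f (k - m) := by
  simp only [fourierCoeff, smul_eq_mul]
  congr 1
  funext x
  rw [← mul_assoc, ← fourier_add]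
  congr 3
  ring

lemma memLp_fourier_mul {f : UnitAddCircle → ℂ} (hf : MemLp f 2 haarAddCircle) (m : ℤ) :
    MemLp (fun x => fourier m x * f x) 2 haarAddCircle := by
  refine hf.of_le ((fourier m).continuous.aestronglyMeasurable.mul hf.1) (ae_of_all _ fun x => ?_)
  rw [norm_mul, norm_fourier_apply, one_mul]

lemma memLp_comp_add_right {f : UnitAddCircle → ℂ} (hf : MemLp f 2 haarAddCircle)
    (a : UnitAddCircle) : MemLp (fun x => f (x + a)) 2 haarAddCircle :=
  hf.comp_measurePreserving (measurePreserving_add_right haarAddCircle a)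

lemma ae_eq_zero_of_fourierCoeff_eq_zero {f : UnitAddCircle → ℂ} (hf : MemLp f 2 haarAddCircle)
    (h : ∀ k, fourierCoeff f k = 0) : f =ᵐ[haarAddCircle] 0 := by
  have h0 : hf.toLp f = 0 := by
    apply fourierBasis.repr.injective
    ext k
    rw [fourierBasis_repr, fourierCoeff_congr_ae hf.coeFn_toLp, h, map_zero]
    rfl
  have h1 := hf.coeFn_toLp
  rw [h0] at h1
  exact h1.symm.trans (Lp.coeFn_zero _ _ _)

/-- Aubry duality for a square-summable eigenfunction: it yields a measurable equivariant section
of the dual transfer cocycle. -/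
lemma exists_dual_section {a t : UnitAddCircle} {lam E : ℝ} (hlam : lam ≠ 0) {u : ℤ → ℂ}
    (hsol : ∀ k : ℤ, u (k + 1) + u (k - 1) + lam * cosSymbol (t + k • a) * u k = E * u k)
    (hl2 : Summable fun k : ℤ => ‖u k‖ ^ 2) (hu : u ≠ 0) :
    ∃ Ψ : UnitAddCircle → Fin 2 → ℂ, Measurable Ψ ∧ (¬ ∀ᵐ x ∂haarAddCircle, Ψ x = 0) ∧
      ∀ᵐ x ∂haarAddCircle, stepMatrix (E / lam) ((lam⁻¹ : ℝ) * cosSymbol x) *ᵥ Ψ x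
        = (fourier 1 t : ℂ) • Ψ (x + a) := by
  have hlam' : (lam : ℂ) ≠ 0 := by exact_mod_cast hlam
  have hmem : Memℓp u 2 := memℓp_gen (by simpa using hl2)
  set F : Lp ℂ 2 (haarAddCircle : Measure UnitAddCircle) :=
    fourierBasis.repr.symm (⟨u, hmem⟩ : lp (fun _ : ℤ => ℂ) 2) with hF
  set φ : UnitAddCircle → ℂ := (F : AddCircle (1 : ℝ) → ℂ) with hφ
  have hφu : ∀ k, fourierCoeff φ k = u k := by
    intro k
    rw [hφ, ← fourierBasis_repr, hF, LinearIsometryEquiv.apply_symm_apply]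
  have hL : MemLp φ 2 haarAddCircle := Lp.memLp F
  have hm : Measurable φ := (Lp.stronglyMeasurable F).measurable
  set D : UnitAddCircle → ℂ := ((fun x => fourier 1 x * φ x) + (fun x => fourier (-1) x * φ x))
    + (((fun x => (lam * fourier 1 t : ℂ) * φ (x + a))
      + fun x => (lam * fourier (-1) t : ℂ) * φ (x + -a)) + fun x => (-E : ℂ) * φ x) with hD
  have m1 := memLp_fourier_mul hL 1
  have m2 := memLp_fourier_mul hL (-1)
  have m3 := (memLp_comp_add_right hL a).const_mul (lam * fourier 1 t : ℂ)
  have m4 := (memLp_comp_add_right hL (-a)).const_mul (lam * fourier (-1) t : ℂ)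
  have m5 := hL.const_mul (-E : ℂ)
  have hDL : MemLp D 2 haarAddCircle := (m1.add m2).add ((m3.add m4).add m5)
  have i {f : UnitAddCircle → ℂ} (hf : MemLp f 2 haarAddCircle) : Integrable f haarAddCircle :=
    hf.integrable one_le_two
  have hD0 : D =ᵐ[haarAddCircle] 0 := by
    refine ae_eq_zero_of_fourierCoeff_eq_zero hDL fun k => ?_
    have hk := hsol k
    rw [cosSymbol, fourier_add_apply, fourier_add_apply] at hk
    have e1 : (fourier 1 (k • a) : ℂ) = fourier k a := by simp [fourier_apply]
    have e2 : (fourier (-1) (k • a) : ℂ) = fourier k (-a) := by simp [fourier_apply]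
    rw [e1, e2] at hk
    rw [hD, fourierCoeff.add (i (m1.add m2)) (i ((m3.add m4).add m5)), Pi.add_apply,
      fourierCoeff.add (i m1) (i m2), fourierCoeff.add (i (m3.add m4)) (i m5),
      Pi.add_apply, Pi.add_apply, fourierCoeff.add (i m3) (i m4), Pi.add_apply,
      fourierCoeff_fourier_mul, fourierCoeff_fourier_mul, fourierCoeff.const_mul,
      fourierCoeff.const_mul, fourierCoeff.const_mul, fourierCoeff_comp_add_right,
      fourierCoeff_comp_add_right, hφu, hφu, hφu, sub_neg_eq_add]
    linear_combination hk
  refine ⟨fun x => ![φ x, fourier (-1) t * φ (x + -a)], ?_, ?_, ?_⟩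
  · refine measurable_pi_iff.2 fun j => ?_
    fin_cases j
    · exact hm
    · exact (hm.comp (measurable_add_const (-a))).const_mul _
  · intro h
    have hφ0 : φ =ᵐ[haarAddCircle] fun _ => 0 := by
      filter_upwards [h] with x hx
      exact congrFun hx 0
    refine hu (funext fun k => ?_)
    rw [← hφu, fourierCoeff_congr_ae hφ0]
    simp [fourierCoeff]
  · filter_upwards [hD0] with x hx
    have ht : (fourier 1 t : ℂ) * fourier (-1) t = 1 := by
      rw [← fourier_add, add_neg_cancel, fourier_zero]
    simp only [hD, Pi.add_apply, Pi.zero_apply] at hx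
    funext j
    fin_cases j
    · simp [stepMatrix, Matrix.mulVec, dotProduct, Fin.sum_univ_two, cosSymbol, -fourier_apply]
      field_simp
      linear_combination -hx
    · simp [stepMatrix, Matrix.mulVec, dotProduct, Fin.sum_univ_two, -fourier_apply]
      linear_combination (-φ x) * ht

lemma continuous_stepMatrix (z : ℂ) : Continuous (stepMatrix z) := by
  refine (LipschitzWith.of_dist_le_mul (K := 1) fun w w' => ?_).continuous
  rw [dist_eq_norm, dist_eq_norm, NNReal.coe_one, one_mul]
  refine (norm_stepMatrix_sub_le z z w w').trans (le_of_eq ?_)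
  rw [sub_self, zero_sub, norm_neg]

lemma continuous_prodSeq {X : Type*} [TopologicalSpace X] {T : X → ℕ → Matrix (Fin 2) (Fin 2) ℂ}
    (hT : ∀ i, Continuous fun x => T x i) (n : ℕ) : Continuous fun x => prodSeq (T x) n := by
  induction n with
  | zero => exact continuous_const
  | succ n ih => exact (hT n).mul ih

lemma continuous_amPotential (c : ℂ) (a : UnitAddCircle) (i : ℕ) :
    Continuous fun x => amPotential c a x i :=
  continuous_const.mul (continuous_cosSymbol.comp (continuous_add_const _))

lemma amPotential_add (c : ℂ) (a x : UnitAddCircle) (i j : ℕ) :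
    amPotential c a x (i + j) = amPotential c a (x + i • a) j := by
  rw [amPotential, amPotential, add_smul, add_assoc]

lemma norm_amPotential_le (c : ℂ) (a x : UnitAddCircle) (i : ℕ) :
    ‖amPotential c a x i‖ ≤ 2 * ‖c‖ := by
  rw [amPotential, norm_mul, mul_comm]
  gcongr
  exact norm_cosSymbol_le _

lemma norm_stepMatrix_amPotential_le (z c : ℂ) (a x : UnitAddCircle) (i : ℕ) :
    ‖stepMatrix z (amPotential c a x i)‖ ≤ ‖z‖ + 2 * ‖c‖ + 1 :=
  norm_stepMatrix_le ((norm_sub_le _ _).trans (by gcongr; exact norm_amPotential_le c a x i))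

lemma one_le_norm_prodSeq_stepMatrix (z : ℂ) (w : ℕ → ℂ) (n : ℕ) :
    1 ≤ ‖prodSeq (fun i => stepMatrix z (w i)) n‖ :=
  one_le_norm_of_det_eq_one (det_prodSeq _ (fun _ => det_stepMatrix _ _) _)

lemma log_norm_prodSeq_mul_le (z : ℂ) (w : ℕ → ℂ) (N m : ℕ) :
    Real.log ‖prodSeq (fun i => stepMatrix z (w i)) (m * N)‖ ≤
      ∑ j ∈ Finset.range m, Real.log ‖prodSeq (fun i => stepMatrix z (w (j * N + i))) N‖ := by
  induction m with
  | zero => simp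
  | succ m ih =>
    have h1 := one_le_norm_prodSeq_stepMatrix z (fun i => w (m * N + i)) N
    have h2 := one_le_norm_prodSeq_stepMatrix z w (m * N)
    have h3 := one_le_norm_prodSeq_stepMatrix z w ((m + 1) * N)
    rw [add_mul, one_mul] at h3
    rw [Finset.sum_range_succ, add_mul, one_mul]
    refine (Real.log_le_log (by linarith) (y := ‖prodSeq (fun i => stepMatrix z (w (m * N + i))) N‖ *
      ‖prodSeq (fun i => stepMatrix z (w i)) (m * N)‖) ?_).trans ?_
    · rw [prodSeq_add]
      exact norm_mul_le _ _
    · rw [Real.log_mul (by linarith) (by linarith)]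
      linarith

lemma log_norm_entry_le (z : ℂ) (w : ℕ → ℂ) (n : ℕ) :
    Real.log ‖prodSeq (fun i => stepMatrix z (w i)) n 0 0‖
      ≤ Real.log ‖prodSeq (fun i => stepMatrix z (w i)) n‖ := by
  rcases eq_or_ne (prodSeq (fun i => stepMatrix z (w i)) n 0 0) 0 with h | h
  · rw [h, norm_zero, Real.log_zero]
    exact Real.log_nonneg (one_le_norm_prodSeq_stepMatrix z w n)
  · exact Real.log_le_log (norm_pos_iff.2 h) (entry_le_norm _ _ _)

/-- A small imaginary regularization of the energy does not change a fixed transfer matrix much. -/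
lemma exists_regularization (lam E : ℝ) (c : ℂ) (a : UnitAddCircle) (hlam : lam ≠ 0) (N : ℕ)
    {ε : ℝ} (hε : 0 < ε) : ∃ r : ℝ, r ≠ 0 ∧ ∀ x,
      Real.log ‖prodSeq (fun i => stepMatrix ((E + r * Complex.I) / lam) (amPotential c a x i)) N‖
        ≤ Real.log ‖prodSeq (fun i => stepMatrix (E / lam) (amPotential c a x i)) N‖ + ε := by
  have hl : 0 < |lam| := abs_pos.2 hlam
  set M := (|E| + 1) / |lam| + 2 * ‖c‖ + 1 with hM
  have hM1 : 1 ≤ M := by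
    have : 0 ≤ (|E| + 1) / |lam| + 2 * ‖c‖ := by positivity
    linarith
  set r := min 1 (ε * |lam| / ((N + 1) * M ^ N)) with hr
  have hr0 : 0 < r := lt_min one_pos (by positivity)
  have hr1 : r ≤ 1 := min_le_left _ _
  have hr2 : (N + 1) * M ^ N * (r / |lam|) ≤ ε := by
    have : r ≤ ε * |lam| / ((N + 1) * M ^ N) := min_le_right _ _
    rw [le_div_iff₀ (by positivity)] at this
    rw [← mul_div_assoc, div_le_iff₀ hl]
    linarith
  refine ⟨r, hr0.ne', fun x => ?_⟩
  have hz : ‖((E : ℂ) + r * Complex.I) / lam‖ ≤ (|E| + 1) / |lam| := by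
    rw [norm_div, Complex.norm_real, Real.norm_eq_abs]
    gcongr
    refine (norm_add_le _ _).trans ?_
    rw [norm_mul, Complex.norm_I, mul_one, Complex.norm_real, Complex.norm_real, Real.norm_eq_abs,
      Real.norm_of_nonneg hr0.le]
    linarith
  have hz' : ‖(E : ℂ) / lam‖ ≤ (|E| + 1) / |lam| := by
    rw [norm_div, Complex.norm_real, Complex.norm_real, Real.norm_eq_abs, Real.norm_eq_abs]
    gcongr
    linarith
  have hT : ∀ i, ‖stepMatrix (((E : ℂ) + r * Complex.I) / lam) (amPotential c a x i)‖ ≤ M :=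
    fun i => (norm_stepMatrix_amPotential_le _ _ _ _ _).trans (by rw [hM]; gcongr)
  have hS : ∀ i, ‖stepMatrix ((E : ℂ) / lam) (amPotential c a x i)‖ ≤ M :=
    fun i => (norm_stepMatrix_amPotential_le _ _ _ _ _).trans (by rw [hM]; gcongr)
  have hTS : ∀ i, ‖stepMatrix (((E : ℂ) + r * Complex.I) / lam) (amPotential c a x i)
      - stepMatrix ((E : ℂ) / lam) (amPotential c a x i)‖ ≤ r / |lam| := by
    intro i
    refine (norm_stepMatrix_sub_le _ _ _ _).trans (le_of_eq ?_)
    rw [sub_self, sub_zero, ← sub_div, add_sub_cancel_left, norm_div, norm_mul, Complex.norm_I,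
      mul_one, Complex.norm_real, Complex.norm_real, Real.norm_eq_abs, Real.norm_eq_abs, abs_of_pos hr0]
  have hd := norm_prodSeq_sub_le hM1 zero_le_one
    (fun n => by rw [one_mul]; exact norm_prodSeq_le hT n)
    (fun j n => by rw [one_mul]; exact norm_prodSeq_le (fun i => hS (j + i)) n) hTS N
  set A := prodSeq (fun i => stepMatrix (((E : ℂ) + r * Complex.I) / lam) (amPotential c a x i)) N
    with hA
  set B := prodSeq (fun i => stepMatrix ((E : ℂ) / lam) (amPotential c a x i)) N with hB
  have hA1 : 1 ≤ ‖A‖ := one_le_norm_prodSeq_stepMatrix _ _ _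
  have hB1 : 1 ≤ ‖B‖ := one_le_norm_prodSeq_stepMatrix _ _ _
  have hAB : ‖A‖ ≤ ‖B‖ + ε := by
    have h1 := norm_sub_norm_le A B
    have h2 : (N : ℝ) * (1 ^ 2 * M ^ N * (r / |lam|)) ≤ (N + 1) * M ^ N * (r / |lam|) := by
      rw [one_pow, one_mul, mul_assoc ((N : ℝ) + 1)]
      gcongr
      linarith
    linarith
  have hAB' : ‖A‖ ≤ ‖B‖ * Real.exp ε := by
    have h3 := Real.add_one_le_exp ε
    nlinarith
  have := Real.log_le_log (by linarith) hAB'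
  rwa [Real.log_mul (by linarith) (Real.exp_pos _).ne', Real.log_exp] at this

lemma exists_sum_le_integral {g : UnitAddCircle → ℝ} (hg : Integrable g haarAddCircle)
    (b : UnitAddCircle) (m : ℕ) :
    ∃ y, ∑ j ∈ Finset.range m, g (y + j • b) ≤ m * ∫ x, g x ∂haarAddCircle := by
  have hi : ∀ j ∈ Finset.range m, Integrable (fun y => g (y + j • b)) haarAddCircle := fun j _ =>
    (measurePreserving_add_right haarAddCircle (j • b)).integrable_comp_of_integrable hg
  obtain ⟨y, hy⟩ := exists_le_integral (integrable_finsetSum _ hi)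
  refine ⟨y, hy.trans (le_of_eq ?_)⟩
  rw [integral_finsetSum _ hi]
  simp [integral_add_right_eq_self (μ := (haarAddCircle : Measure UnitAddCircle)) g]

/-- An `ℓ²` eigenfunction at coupling `lam` forces the transfer matrices at coupling `lam` to grow
at exponential rate at most `max 0 (log |lam|)`, uniformly in the phase. -/
theorem exists_norm_prodSeq_le {a t : UnitAddCircle} (ha : addOrderOf a = 0) {lam E : ℝ}
    (hlam : lam ≠ 0) {u : ℤ → ℂ}
    (hsol : ∀ k : ℤ, u (k + 1) + u (k - 1) + lam * cosSymbol (t + k • a) * u k = E * u k)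
    (hl2 : Summable fun k : ℤ => ‖u k‖ ^ 2) (hu : u ≠ 0) {κ : ℝ} (hκ0 : 0 < κ)
    (hκ : Real.log |lam| < κ) :
    ∃ C : ℝ, 0 ≤ C ∧ ∀ n x,
      ‖prodSeq (fun i => stepMatrix E (amPotential lam a x i)) n‖ ≤ C * Real.exp κ ^ n := by
  set ε := (κ - Real.log |lam|) / 3 with hε
  have hε0 : 0 < ε := by rw [hε]; linarith
  obtain ⟨Ψ, hΨ, hΨ0, heq⟩ := exists_dual_section hlam hsol hl2 hu
  have hbd : ∀ x : UnitAddCircle, ‖stepMatrix ((E : ℂ) / lam) ((lam⁻¹ : ℝ) * cosSymbol x)‖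
      ≤ ‖(E : ℂ) / lam‖ + 2 * ‖((lam⁻¹ : ℝ) : ℂ)‖ + 1 := fun x => by
    simpa [amPotential] using norm_stepMatrix_amPotential_le ((E : ℂ) / lam) (lam⁻¹ : ℝ) a x 0
  have hω : ‖(fourier 1 t : ℂ)‖ = 1 := norm_fourier_apply _ _
  obtain ⟨N, hN1, hN⟩ := exists_integral_log_norm_le ha (fun x => det_stepMatrix _ _) hbd hω hΨ hΨ0
    heq hε0
  obtain ⟨r, hr, hreg⟩ := exists_regularization lam E ((lam⁻¹ : ℝ) : ℂ) a hlam N hε0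
  obtain ⟨N₀, hN₀⟩ := entry_le_dual_entry ha hlam E hr hε0
  set g : UnitAddCircle → ℝ := fun x => Real.log ‖prodSeq (fun i => stepMatrix ((E : ℂ) / lam)
    (amPotential (lam⁻¹ : ℝ) a x i)) N‖ with hg
  have hgc : Continuous g := by
    refine Continuous.log (continuous_prodSeq (fun i => (continuous_stepMatrix _).comp
      (continuous_amPotential _ _ _)) N).norm fun x => ?_
    exact (zero_lt_one.trans_le (one_le_norm_prodSeq_stepMatrix _ _ _)).ne'
  have hgi : ∫ x, g x ∂haarAddCircle ≤ ε * N := hN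
  obtain ⟨y, hy⟩ := exists_sum_le_integral
    (hgc.integrable_of_hasCompactSupport (HasCompactSupport.of_compactSpace g)) (N • a) (N₀ + 1)
  set m := (N₀ + 1) * N with hm
  have hm1 : N₀ + 1 ≤ m := Nat.le_mul_of_pos_right _ hN1
  have hmpos : (0 : ℝ) < m := by
    have : 0 < m := by omega
    exact_mod_cast this
  have hgrow : Real.log ‖prodSeq (fun i => stepMatrix ((E + r * Complex.I) / lam)
      (amPotential (lam⁻¹ : ℝ) a y i)) m 0 0‖ / m ≤ 2 * ε := by
    rw [div_le_iff₀ hmpos]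
    refine (log_norm_entry_le _ _ _).trans ((log_norm_prodSeq_mul_le _ _ N (N₀ + 1)).trans ?_)
    have h1 : ∀ j ∈ Finset.range (N₀ + 1), Real.log ‖prodSeq (fun i =>
        stepMatrix (((E : ℂ) + r * Complex.I) / lam)
          (amPotential (lam⁻¹ : ℝ) a y (j * N + i))) N‖ ≤ g (y + j • (N • a)) + ε := by
      intro j _
      simp only [amPotential_add, mul_smul]
      exact hreg _
    refine (Finset.sum_le_sum h1).trans ?_
    rw [Finset.sum_add_distrib, Finset.sum_const, Finset.card_range, nsmul_eq_mul]
    have h2 : ((N₀ + 1 : ℕ) : ℝ) * ∫ x, g x ∂haarAddCircle ≤ (N₀ + 1 : ℕ) * (ε * N) := by gcongr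
    have h3 : ((N₀ + 1 : ℕ) : ℝ) * ε ≤ (N₀ + 1 : ℕ) * (ε * N) := by
      gcongr
      have : (1 : ℝ) ≤ N := by exact_mod_cast hN1
      nlinarith
    have h4 : (m : ℝ) = (N₀ + 1 : ℕ) * N := by rw [hm, Nat.cast_mul]
    rw [h4]
    linarith
  have hentry : ∀ n : ℕ, N₀ ≤ n → ∀ x,
      ‖prodSeq (fun i => stepMatrix E (amPotential lam a x i)) n 0 0‖ ≤ Real.exp (n * κ) := by
    intro n hn x
    refine (hN₀ n m hn (by omega) x y).trans (Real.exp_le_exp.2 ?_)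
    gcongr
    have : κ = Real.log |lam| + 3 * ε := by rw [hε]; ring
    linarith
  set M := ‖(E : ℂ)‖ + 2 * ‖(lam : ℂ)‖ + 1 with hM
  have hM1 : 1 ≤ M := by
    have : 0 ≤ ‖(E : ℂ)‖ + 2 * ‖(lam : ℂ)‖ := by positivity
    linarith
  refine ⟨2 + M ^ (N₀ + 2), by positivity, fun n x => ?_⟩
  have he1 : 1 ≤ Real.exp κ ^ n := one_le_pow₀ (Real.one_le_exp hκ0.le)
  rcases lt_or_ge n (N₀ + 2) with hn | hn
  · have h1 := norm_prodSeq_le (fun i => norm_stepMatrix_amPotential_le E lam a x i) n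
    have h2 : M ^ n ≤ M ^ (N₀ + 2) := pow_le_pow_right₀ hM1 hn.le
    have h3 : 0 ≤ M ^ (N₀ + 2) := by positivity
    nlinarith
  · obtain ⟨k, rfl⟩ : ∃ k, n = k + 2 := ⟨n - 2, by omega⟩
    have h1 : ‖prodSeq (fun i => stepMatrix E (amPotential lam a x i)) (k + 2)‖
        ≤ 2 * Real.exp ((k + 2 : ℕ) * κ) := by
      refine norm_prodSeq_le_of_entry fun j l hl hl' => ?_
      simp only [add_comm _ j, amPotential_add]
      refine (hentry l (by omega) _).trans (Real.exp_le_exp.2 ?_)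
      gcongr
    rw [Real.exp_nat_mul] at h1
    have h3 : 0 ≤ M ^ (N₀ + 2) := by positivity
    nlinarith

lemma mulVec_mulVec_of_det_eq_one {A : Matrix (Fin 2) (Fin 2) ℂ} (hA : A.det = 1)
    (v : Fin 2 → ℂ) : A *ᵥ (A *ᵥ v) = A.trace • (A *ᵥ v) - v := by
  rw [Matrix.det_fin_two] at hA
  ext i
  fin_cases i <;>
    simp [Matrix.mulVec, dotProduct, Fin.sum_univ_two, Matrix.trace_fin_two]
  · linear_combination (-v 0) * hA
  · linear_combination (-v 1) * hA

lemma norm_trace_sub_le (A B : Matrix (Fin 2) (Fin 2) ℂ) :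
    ‖A.trace - B.trace‖ ≤ 2 * ‖A - B‖ := by
  rw [← Matrix.trace_sub, Matrix.trace_fin_two]
  have h0 := entry_le_norm (A - B) 0 0
  have h1 := entry_le_norm (A - B) 1 1
  linarith [norm_add_le ((A - B) 0 0) ((A - B) 1 1)]

/-- Gordon's argument: almost repeated unimodular blocks forbid decay. -/
lemma eq_zero_of_repeated_blocks {A B D : Matrix (Fin 2) (Fin 2) ℂ} (hA : A.det = 1)
    (hD : D.det = 1) {v₀ v₁ v₂ w : Fin 2 → ℂ} (h1 : A *ᵥ v₀ = v₁) (h2 : B *ᵥ v₁ = v₂)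
    (h3 : D *ᵥ w = v₀) (hAB : ‖A - B‖ ≤ 1 / 8) (hAD : ‖A - D‖ ≤ 1 / 8)
    (hv₁ : ‖v₁‖ ≤ ‖v₀‖ / 8) (hv₂ : ‖v₂‖ ≤ ‖v₀‖ / 8) (hw : ‖w‖ ≤ ‖v₀‖ / 8) : v₀ = 0 := by
  have hs := norm_nonneg v₀
  have e1 := mulVec_mulVec_of_det_eq_one hA v₀
  have e2 := mulVec_mulVec_of_det_eq_one hD w
  rw [h1] at e1
  rw [h3] at e2
  have f1 : v₀ = A.trace • v₁ - ((A - B) *ᵥ v₁ + v₂) := by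
    rw [Matrix.sub_mulVec, e1, h2]; abel
  have f2 : D.trace • v₀ = v₁ - (A - D) *ᵥ v₀ + w := by
    rw [Matrix.sub_mulVec, h1, e2]; abel
  have g1 : ‖v₀‖ ≤ ‖A.trace‖ * ‖v₁‖ + (‖A - B‖ * ‖v₁‖ + ‖v₂‖) := by
    conv_lhs => rw [f1]
    refine (norm_sub_le _ _).trans (add_le_add (norm_smul_le _ _) ((norm_add_le _ _).trans ?_))
    gcongr
    exact Matrix.linfty_opNorm_mulVec _ _
  have g2 : ‖D.trace‖ * ‖v₀‖ ≤ ‖v₁‖ + ‖A - D‖ * ‖v₀‖ + ‖w‖ := by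
    rw [← norm_smul, f2]
    refine (norm_add_le _ _).trans ?_
    gcongr
    refine (norm_sub_le _ _).trans ?_
    gcongr
    exact Matrix.linfty_opNorm_mulVec _ _
  by_contra hne
  have hpos : 0 < ‖v₀‖ := norm_pos_iff.2 hne
  have hAD' : ‖A - D‖ * ‖v₀‖ ≤ 1 / 8 * ‖v₀‖ := by gcongr
  have hτD : ‖D.trace‖ ≤ 3 / 8 := by
    refine le_of_mul_le_mul_right ?_ hpos
    linarith
  have hτA : ‖A.trace‖ ≤ 5 / 8 := by
    have := norm_trace_sub_le A D
    have := norm_sub_norm_le A.trace D.trace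
    linarith
  have hv : ‖A.trace‖ * ‖v₁‖ ≤ 5 / 8 * (‖v₀‖ / 8) := by gcongr
  have hv' : ‖A - B‖ * ‖v₁‖ ≤ 1 / 8 * (‖v₀‖ / 8) := by gcongr
  linarith

/-- The vector `(u k, u (k - 1))`. -/
def stateVec (u : ℤ → ℂ) (k : ℤ) : Fin 2 → ℂ := ![u k, u (k - 1)]

lemma norm_stateVec_le_iff {u : ℤ → ℂ} {k : ℤ} {r : ℝ} (hr : 0 ≤ r) :
    ‖stateVec u k‖ ≤ r ↔ ‖u k‖ ≤ r ∧ ‖u (k - 1)‖ ≤ r := by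
  rw [pi_norm_le_iff_of_nonneg hr, Fin.forall_fin_two]
  simp [stateVec]

lemma prodSeq_mulVec_stateVec {a t : UnitAddCircle} {lam E : ℝ} {u : ℤ → ℂ}
    (hsol : ∀ k : ℤ, u (k + 1) + u (k - 1) + lam * cosSymbol (t + k • a) * u k = E * u k)
    (j : ℤ) (n : ℕ) :
    prodSeq (fun i => stepMatrix E (amPotential lam a (t + j • a) i)) n *ᵥ stateVec u j
      = stateVec u (j + n) := by
  induction n with
  | zero => simp
  | succ n ih =>
    rw [prodSeq_succ, ← Matrix.mulVec_mulVec, ih]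
    have h := hsol (j + n)
    have hx : t + (j + (n : ℤ)) • a = t + j • a + n • a := by
      rw [add_smul, natCast_zsmul, add_assoc]
    rw [hx] at h
    have h' : u (j + n + 1)
        = (E - lam * cosSymbol (t + j • a + n • a)) * u (j + n) - u (j + n - 1) := by
      linear_combination h
    ext i
    fin_cases i
    · simp [stepMatrix, stateVec, amPotential, ← add_assoc, h', ← sub_eq_add_neg, mul_comm]
    · simp [stepMatrix, stateVec, ← add_assoc]

lemma eq_zero_of_stateVec_eq_zero {V u : ℤ → ℂ} {E : ℂ}
    (hsol : ∀ k : ℤ, u (k + 1) + u (k - 1) + V k * u k = E * u k)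
    (h0 : stateVec u 0 = 0) : u = 0 := by
  have h00 : u 0 = 0 := by simpa [stateVec] using congrFun h0 0
  have h01 : u (-1) = 0 := by simpa [stateVec] using congrFun h0 1
  have key : ∀ k : ℤ, u k = 0 ∧ u (k - 1) = 0 := by
    intro k
    induction k using Int.induction_on with
    | zero => exact ⟨h00, by simpa using h01⟩
    | succ n ih =>
      have h := hsol n
      rw [ih.1, ih.2] at h
      exact ⟨by simpa using h, by simpa using ih.1⟩
    | pred n ih =>
      have h := hsol (-n - 1)
      rw [sub_add_cancel, ih.1, ih.2] at h
      exact ⟨ih.2, by simpa using h⟩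
  exact funext fun k => (key k).1

lemma eq_zero_of_frequently_repeated {a t : UnitAddCircle} {lam E : ℝ} {u : ℤ → ℂ}
    (hsol : ∀ k : ℤ, u (k + 1) + u (k - 1) + lam * cosSymbol (t + k • a) * u k = E * u k)
    (hl2 : Summable fun k : ℤ => ‖u k‖ ^ 2)
    (h : ∃ᶠ q : ℕ in atTop, ∀ s : ℤ, (s = q ∨ s = -q) →
      ‖prodSeq (fun i => stepMatrix E (amPotential lam a t i)) q
        - prodSeq (fun i => stepMatrix E (amPotential lam a (t + s • a) i)) q‖ ≤ 1 / 8) :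
    u = 0 := by
  refine eq_zero_of_stateVec_eq_zero hsol ?_
  by_contra hne
  set δ := ‖stateVec u 0‖ / 8 with hδ
  have hδ0 : 0 < δ := by have := norm_pos_iff.2 hne; positivity
  have hu : Tendsto (fun k => ‖u k‖ ^ 2) cofinite (nhds 0) := hl2.tendsto_cofinite_zero
  have hev : ∀ᶠ k in cofinite, ‖u k‖ ≤ δ := by
    filter_upwards [hu.eventually (gt_mem_nhds (show (0 : ℝ) < δ ^ 2 by positivity))] with k hk
    exact (abs_lt_of_sq_lt_sq' hk hδ0.le).2.le
  have hev' : ∀ᶠ k in cofinite, ‖stateVec u k‖ ≤ δ := by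
    have hinj : Function.Injective fun k : ℤ => k - 1 := sub_left_injective
    filter_upwards [hev, hinj.tendsto_cofinite.eventually hev] with k h1 h2
    exact (norm_stateVec_le_iff hδ0.le).2 ⟨h1, h2⟩
  have hlim : ∀ c : ℤ, c ≠ 0 → ∀ᶠ q : ℕ in atTop, ‖stateVec u (c * q)‖ ≤ δ := by
    intro c hc
    have hinj : Function.Injective fun q : ℕ => c * (q : ℤ) :=
      (mul_right_injective₀ hc).comp Nat.cast_injective
    rw [← Nat.cofinite_eq_atTop]
    exact hinj.tendsto_cofinite.eventually hev'
  obtain ⟨q, hq, hp, hpp, hm⟩ := (h.and_eventually ((hlim 1 one_ne_zero).and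
    ((hlim 2 two_ne_zero).and (hlim (-1) (by norm_num))))).exists
  rw [one_mul] at hp
  rw [neg_one_mul] at hm
  have hdet : ∀ x, (prodSeq (fun i => stepMatrix E (amPotential lam a x i)) q).det = 1 :=
    fun x => det_prodSeq _ (fun i => det_stepMatrix _ _) q
  have e1 := prodSeq_mulVec_stateVec hsol 0 q
  have e2 := prodSeq_mulVec_stateVec hsol q q
  have e3 := prodSeq_mulVec_stateVec hsol (-q) q
  rw [zero_smul, add_zero, zero_add] at e1
  rw [← two_mul] at e2
  rw [neg_add_cancel] at e3
  exact hne (eq_zero_of_repeated_blocks (hdet _) (hdet _) e1 e2 e3 (hq _ (.inl rfl))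
    (hq _ (.inr rfl)) hp hpp hm)

lemma norm_cosSymbol_add_coe_sub_le (x : UnitAddCircle) (s : ℝ) :
    ‖cosSymbol x - cosSymbol (x + (s : UnitAddCircle))‖ ≤ 4 * Real.pi * |s| := by
  have key : ∀ n : ℤ, |(n : ℝ)| = 1 →
      ‖(fourier n x : ℂ) - fourier n (x + (s : UnitAddCircle))‖ ≤ 2 * Real.pi * |s| := by
    intro n hn
    rw [fourier_add_apply, ← mul_one_sub, norm_mul, norm_fourier_apply, one_mul, norm_sub_rev]
    have h1 := Real.norm_exp_I_mul_ofReal_sub_one_le (x := 2 * Real.pi * n * s)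
    rw [fourier_coe_apply]
    refine le_trans (le_of_eq ?_) (h1.trans (le_of_eq ?_))
    · congr 3; push_cast; ring
    · rw [Real.norm_eq_abs, abs_mul, abs_mul, abs_mul, hn, abs_of_pos Real.pi_pos]
      norm_num
  have h1 := key 1 (by norm_num)
  have h2 := key (-1) (by norm_num)
  rw [cosSymbol, cosSymbol, add_sub_add_comm]
  refine (norm_add_le _ _).trans ?_
  linarith

lemma natCast_smul_coe_eq (α : ℝ) (q : ℕ) :
    q • (α : UnitAddCircle) = ((q * α - round (q * α) : ℝ) : UnitAddCircle) := by
  have h : ((round (q * α) : ℝ) : UnitAddCircle) = 0 :=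
    (AddCircle.coe_eq_zero_iff 1).2 ⟨round (q * α), by simp⟩
  rw [AddCircle.coe_sub, h, sub_zero, ← nsmul_eq_mul, AddCircle.coe_nsmul]

lemma norm_stepMatrix_amPotential_sub_le (E : ℂ) (lam : ℂ) (a x : UnitAddCircle) (s : ℝ) (i : ℕ) :
    ‖stepMatrix E (amPotential lam a x i)
      - stepMatrix E (amPotential lam a (x + (s : UnitAddCircle)) i)‖
      ≤ ‖lam‖ * (4 * Real.pi * |s|) := by
  refine (norm_stepMatrix_sub_le _ _ _ _).trans ?_
  rw [sub_self, zero_sub, norm_neg, amPotential, amPotential, ← mul_sub, norm_mul, add_right_comm]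
  gcongr
  exact norm_cosSymbol_add_coe_sub_le _ _

lemma frequently_norm_prodSeq_sub_le {α : ℝ} {t : UnitAddCircle} {lam E C κ : ℝ} (hκ0 : 0 < κ)
    (hκ : κ < beta α) (hC : 0 ≤ C)
    (hbd : ∀ n x, ‖prodSeq (fun i => stepMatrix E (amPotential lam (α : UnitAddCircle) x i)) n‖
      ≤ C * Real.exp κ ^ n) :
    ∃ᶠ q : ℕ in atTop, ∀ s : ℤ, (s = q ∨ s = -q) →
      ‖prodSeq (fun i => stepMatrix E (amPotential lam (α : UnitAddCircle) t i)) q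
        - prodSeq (fun i => stepMatrix E
          (amPotential lam (α : UnitAddCircle) (t + s • (α : UnitAddCircle)) i)) q‖ ≤ 1 / 8 := by
  obtain ⟨κ', hκκ', hκ'⟩ := EReal.lt_iff_exists_real_btwn.1 hκ
  replace hκκ' : κ < κ' := EReal.coe_lt_coe_iff.1 hκκ'
  have hfreq := frequently_lt_of_lt_limsup (by isBoundedDefault) hκ'
  have hr : |Real.exp (κ - κ')| < 1 := by
    rw [abs_of_pos (Real.exp_pos _)]
    simpa using hκκ'
  have hlim := (tendsto_self_mul_const_pow_of_abs_lt_one hr).const_mul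
    (C ^ 2 * (|lam| * (4 * Real.pi)))
  rw [mul_zero] at hlim
  have hev := hlim.eventually (gt_mem_nhds (show (0 : ℝ) < 1 / 8 by norm_num))
  refine (hfreq.and_eventually (hev.and (eventually_gt_atTop 0))).mono ?_
  rintro q ⟨hq, hq', hq0⟩ s hs
  have hq0' : (0 : ℝ) < q := by exact_mod_cast hq0
  set d := (q : ℝ) * α - round ((q : ℝ) * α) with hd
  have hdle : |d| ≤ Real.exp (-κ') ^ q := by
    rcases eq_or_ne d 0 with h | h
    · rw [h, abs_zero]; positivity
    · have h1 := (lt_div_iff₀ hq0').1 (EReal.coe_lt_coe_iff.1 hq)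
      rw [← Real.exp_nat_mul, ← Real.log_le_iff_le_exp (abs_pos.2 h)]
      linarith
  obtain ⟨s', hs', hss'⟩ : ∃ s' : ℝ, |s'| = |d| ∧ s • (α : UnitAddCircle) = (s' : ℝ) := by
    rcases hs with rfl | rfl
    · exact ⟨d, rfl, by rw [natCast_zsmul, natCast_smul_coe_eq]⟩
    · exact ⟨-d, abs_neg d, by rw [neg_smul, natCast_zsmul, natCast_smul_coe_eq, AddCircle.coe_neg]⟩
  rw [hss']
  refine (norm_prodSeq_sub_le (Real.one_le_exp hκ0.le) hC (fun n => hbd n t) (fun j n => ?_)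
    (fun i => norm_stepMatrix_amPotential_sub_le _ _ _ _ _ i) q).trans (le_trans ?_ hq'.le)
  · simp only [amPotential_add]
    exact hbd n _
  · rw [hs', Complex.norm_real, Real.norm_eq_abs]
    have : Real.exp (κ - κ') ^ q = Real.exp κ ^ q * Real.exp (-κ') ^ q := by
      rw [← mul_pow, ← Real.exp_add, ← sub_eq_add_neg]
    rw [this]
    calc (q : ℝ) * (C ^ 2 * Real.exp κ ^ q * (|lam| * (4 * Real.pi * |d|)))
        ≤ q * (C ^ 2 * Real.exp κ ^ q * (|lam| * (4 * Real.pi * Real.exp (-κ') ^ q))) := by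
          have := Real.pi_pos
          gcongr
      _ = _ := by ring

lemma addOrderOf_coe_eq_zero {α : ℝ} (hα : Irrational α) :
    addOrderOf (α : UnitAddCircle) = 0 := by
  rw [addOrderOf_eq_zero_iff']
  intro n hn h
  rw [← AddCircle.coe_nsmul, AddCircle.coe_eq_zero_iff] at h
  obtain ⟨m, hm⟩ := h
  rw [zsmul_eq_mul, mul_one, nsmul_eq_mul] at hm
  exact (hα.natCast_mul hn.ne').ne_int m hm.symm

lemma ofReal_two_mul_cos (θ α : ℝ) (k : ℤ) :
    ((2 * Real.cos (2 * Real.pi * (θ + (k : ℝ) * α)) : ℝ) : ℂ)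
      = cosSymbol ((θ : UnitAddCircle) + k • (α : UnitAddCircle)) := by
  have h : (θ : UnitAddCircle) + k • (α : UnitAddCircle)
      = ((θ + (k : ℝ) * α : ℝ) : UnitAddCircle) := by
    rw [AddCircle.coe_add, ← zsmul_eq_mul, AddCircle.coe_zsmul]
  rw [h, cosSymbol, fourier_coe_apply, fourier_coe_apply, Complex.ofReal_mul, Complex.ofReal_cos,
    Complex.ofReal_ofNat, Complex.two_cos]
  congr 2 <;> push_cast <;> ring

lemma coe_log_abs_lt_beta {α lam : ℝ} (hlam0 : lam ≠ 0)
    (hlam : ENNReal.ofReal |lam| < EReal.exp (beta α)) :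
    ((Real.log |lam| : ℝ) : EReal) < beta α := by
  rwa [← EReal.exp_lt_exp_iff, EReal.exp_coe, Real.exp_log (abs_pos.2 hlam0)]

end

/-- Corollary 2: for `β(α) > 0` and `|λ| < e^{β(α)}`, the almost Mathieu operator
`H_{λ,α,θ}` has no eigenvalues. -/
theorem almostMathieu_no_eigenvalues
    (α : ℝ) (hα : Irrational α) (hβ : 0 < beta α)
    (lam : ℝ) (hlam : ENNReal.ofReal |lam| < EReal.exp (beta α))
    (θ : ℝ) (E : ℝ)
    (u : ℤ → ℂ)
    (hsol : ∀ k : ℤ,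
      u (k + 1) + u (k - 1)
        + ((2 * lam * Real.cos (2 * Real.pi * (θ + (k : ℝ) * α)) : ℝ) : ℂ) * u k
        = (E : ℂ) * u k)
    (hl2 : Summable fun k : ℤ => ‖u k‖ ^ 2) :
    u = 0 := by
  have hsol' : ∀ k : ℤ, u (k + 1) + u (k - 1)
      + lam * cosSymbol ((θ : UnitAddCircle) + k • (α : UnitAddCircle)) * u k = E * u k := by
    intro k
    rw [← hsol k, ← ofReal_two_mul_cos]
    push_cast
    ring
  rcases eq_or_ne lam 0 with rfl | hlam0
  · exact eq_zero_of_frequently_repeated hsol' hl2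
      (Eventually.of_forall fun q s _ => by simp [amPotential]).frequently
  by_contra hu
  have hmax : ((max 0 (Real.log |lam|) : ℝ) : EReal) < beta α := by
    rcases max_cases 0 (Real.log |lam|) with ⟨h, _⟩ | ⟨h, _⟩ <;> rw [h]
    · exact_mod_cast hβ
    · exact coe_log_abs_lt_beta hlam0 hlam
  obtain ⟨κ, hκ, hκβ⟩ := EReal.lt_iff_exists_real_btwn.1 hmax
  obtain ⟨hκ0, hκlam⟩ := max_lt_iff.1 (EReal.coe_lt_coe_iff.1 hκ)
  obtain ⟨C, hC, hbd⟩ := exists_norm_prodSeq_le (addOrderOf_coe_eq_zero hα) hlam0 hsol' hl2 hu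
    hκ0 hκlam
  exact hu (eq_zero_of_frequently_repeated hsol' hl2
    (frequently_norm_prodSeq_sub_le hκ0 hκβ hC hbd))
end
end

section
/- Let E ∈ ℂ, δ > 0, and let V, V' : ℤ → ℝ be potentials with |V(k) − V'(k)| ≤ δ for all k ∈ ℤ. Suppose u, u' ∈ ℓ²(ℤ) are solutions of u(k+1) + u(k−1) + V(k)u(k) = E u(k) and u'(k+1) + u'(k−1) + V'(k)u'(k) = E u'(k) respectively, with ‖u‖_{ℓ²} = ‖u'‖_{ℓ²} = 1. Then |W(u,u')(k)| ≤ δ for every k ∈ ℤ. -/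
noncomputable section

/-- Wronskian of two sequences: `W(f,g)(k) = f(k+1)g(k) − f(k)g(k+1)`. -/
def wronskian (f g : ℤ → ℂ) (k : ℤ) : ℂ :=
  f (k + 1) * g k - f k * g (k + 1)

open Filter Topology

theorem wronskian_sub_wronskian_pred {E : ℂ} {V V' : ℤ → ℝ} {u u' : ℤ → ℂ}
    (hu : ∀ k : ℤ, u (k + 1) + u (k - 1) + (V k : ℂ) * u k = E * u k)
    (hu' : ∀ k : ℤ, u' (k + 1) + u' (k - 1) + (V' k : ℂ) * u' k = E * u' k) (k : ℤ) :
    wronskian u u' k - wronskian u u' (k - 1) = ((V' k - V k : ℝ) : ℂ) * (u k * u' k) := by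
  simp only [wronskian, sub_add_cancel]
  push_cast
  linear_combination u' k * hu k - u k * hu' k

theorem tendsto_cofinite_zero_of_summable_sq {ι : Type*} {u : ι → ℂ}
    (hu : Summable fun k => ‖u k‖ ^ 2) : Tendsto u cofinite (𝓝 0) := by
  rw [tendsto_zero_iff_norm_tendsto_zero]
  simpa [Real.sqrt_sq (norm_nonneg _)] using hu.tendsto_cofinite_zero.sqrt

theorem tendsto_wronskian_cofinite_zero {u u' : ℤ → ℂ}
    (hu : Summable fun k => ‖u k‖ ^ 2) (hu' : Summable fun k => ‖u' k‖ ^ 2) :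
    Tendsto (wronskian u u') cofinite (𝓝 0) := by
  have h := tendsto_cofinite_zero_of_summable_sq hu
  have h' := tendsto_cofinite_zero_of_summable_sq hu'
  have hs : Tendsto (fun k : ℤ => k + 1) cofinite cofinite :=
    (add_left_injective (1 : ℤ)).tendsto_cofinite
  have hW := ((h.comp hs).mul h').sub (h.mul (h'.comp hs))
  rw [mul_zero, sub_zero] at hW
  exact hW

/-- A sequence vanishing at infinity with summable increments is bounded by their sum. -/
theorem norm_le_tsum_of_norm_sub_pred_le {w : ℤ → ℂ} {g : ℤ → ℝ} (hw : Tendsto w cofinite (𝓝 0))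
    (hg : Summable g) (h : ∀ k, ‖w k - w (k - 1)‖ ≤ g k) (k : ℤ) : ‖w k‖ ≤ ∑' j, g j := by
  have hg0 : ∀ j, 0 ≤ g j := fun j => (norm_nonneg _).trans (h j)
  have hinj : Function.Injective fun n : ℕ => k - (n : ℤ) := fun a b hab => by
    simpa using hab
  have hsum : ∀ n : ℕ, ‖w k‖ ≤ ‖w (k - n)‖ + ∑ i ∈ Finset.range n, g (k - i) := by
    intro n
    induction n with
    | zero => simp
    | succ n ih =>
      have h1 := norm_le_norm_add_norm_sub' (w (k - n)) (w (k - n - 1))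
      have h2 := h (k - n)
      rw [Finset.sum_range_succ, Nat.cast_succ, ← sub_sub]
      linarith
  have hbound : ∀ n : ℕ, ‖w k‖ ≤ ‖w (k - n)‖ + ∑' j, g j := fun n =>
    (hsum n).trans <| add_le_add_right
      (((hg.comp_injective hinj).sum_le_tsum _ fun i _ => hg0 _).trans
        (tsum_comp_le_tsum_of_inj hg hg0 hinj)) _
  have hlim : Tendsto (fun n : ℕ => ‖w (k - n)‖ + ∑' j, g j) atTop (𝓝 (∑' j, g j)) := by
    have := (hw.comp hinj.tendsto_cofinite).norm
    rw [Nat.cofinite_eq_atTop] at this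
    simpa using this.add_const (∑' j, g j)
  exact ge_of_tendsto' hlim hbound

/-- Estimate (2.9): for normalized `ℓ²` solutions of `δ`-close potentials,
`|W(u,u')(k)| ≤ δ` for all `k ∈ ℤ`. -/
theorem wronskian_le_delta
    (E : ℂ) (δ : ℝ) (hδ : 0 < δ)
    (V V' : ℤ → ℝ) (hVV' : ∀ k : ℤ, |V k - V' k| ≤ δ)
    (u u' : ℤ → ℂ)
    (hu : ∀ k : ℤ, u (k + 1) + u (k - 1) + (V k : ℂ) * u k = E * u k)
    (hu' : ∀ k : ℤ, u' (k + 1) + u' (k - 1) + (V' k : ℂ) * u' k = E * u' k)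
    (hu2 : Summable fun k : ℤ => ‖u k‖ ^ 2)
    (hu'2 : Summable fun k : ℤ => ‖u' k‖ ^ 2)
    (hnu : ∑' k : ℤ, ‖u k‖ ^ 2 = 1)
    (hnu' : ∑' k : ℤ, ‖u' k‖ ^ 2 = 1) :
    ∀ k : ℤ, ‖wronskian u u' k‖ ≤ δ := by
  have hg : HasSum (fun k => δ / 2 * (‖u k‖ ^ 2 + ‖u' k‖ ^ 2)) δ := by
    have := (hu2.hasSum.add hu'2.hasSum).mul_left (δ / 2)
    rwa [hnu, hnu', one_add_one_eq_two, div_mul_cancel₀ δ two_ne_zero] at this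
  intro k
  rw [← hg.tsum_eq]
  refine norm_le_tsum_of_norm_sub_pred_le (tendsto_wronskian_cofinite_zero hu2 hu'2)
    hg.summable (fun j => ?_) k
  rw [wronskian_sub_wronskian_pred hu hu', norm_mul, norm_mul, Complex.norm_real,
    Real.norm_eq_abs, abs_sub_comm]
  calc |V j - V' j| * (‖u j‖ * ‖u' j‖) ≤ δ * (‖u j‖ * ‖u' j‖) := by
        gcongr
        exact hVV' j
    _ ≤ δ / 2 * (‖u j‖ ^ 2 + ‖u' j‖ ^ 2) := by
        nlinarith [mul_nonneg hδ.le (sq_nonneg (‖u j‖ - ‖u' j‖))]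
end
end
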